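/- arXiv:math/0202001 — 6 statements merged into one kernel-verified Lean document; each statement's English description precedes it below -/
import Mathlib

section
/- Let a, b : {0,1}^ω → {0,1}^ω be the unique maps satisfying a(0w) = 1·b(w), a(1w) = 0·a(w), b(0w) = 0·b(w), b(1w) = 1·a(w) for all w ∈ {0,1}^ω. Let Φ : {0,1}^ω → (ℤ/2ℤ)[[t]] be defined by Φ(x₁x₂x₃…) = Σ_{i≥1} x_i·t^{i−1}. Then a and b are bijections and for every w ∈ {0,1}^ω one has Φ(a(w)) = (1+t)·Φ(w) + 1 and Φ(b(w)) = (1+t)·Φ(w); equivalently, Φ(a(b^{−1}(w))) = Φ(w) + 1 and Φ(b(w)) = (1+t)·Φ(w). -/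
/-- Prepend a letter to an infinite binary sequence: `cns x w = xw`. -/
def cns (x : Bool) (w : ℕ → Bool) : ℕ → Bool :=
  fun n => match n with
  | 0 => x
  | k + 1 => w k

/-- The map `Φ : {0,1}^ω → (ℤ/2ℤ)[[t]]`, `Φ(x₁x₂x₃…) = Σ_{i≥1} x_i·t^{i−1}`. -/
def PhiPS (w : ℕ → Bool) : PowerSeries (ZMod 2) :=
  PowerSeries.mk fun i => if w i then 1 else 0

theorem cns_head_tail (w : ℕ → Bool) : cns (w 0) (fun n => w (n + 1)) = w := by
  funext n
  cases n <;> rfl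

theorem PhiPS_cns (x : Bool) (w : ℕ → Bool) :
    PhiPS (cns x w) = (if x then 1 else 0) + PowerSeries.X * PhiPS w := by
  ext n
  cases n with
  | zero => cases x <;> simp [PhiPS, cns]
  | succ n => cases x <;> simp [PhiPS, cns, PowerSeries.coeff_succ_X_mul, PowerSeries.coeff_one] <;> rfl

theorem PhiPS_bijective : Function.Bijective PhiPS := by
  constructor
  · intro v w h
    funext n
    have hn := congrArg (PowerSeries.coeff n) h
    simp only [PhiPS, PowerSeries.coeff_mk] at hn
    cases hv : v n <;> cases hw : w n <;> simp_all
  · intro p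
    refine ⟨fun n => decide (PowerSeries.coeff n p = 1), ?_⟩
    ext n
    simp only [PhiPS, PowerSeries.coeff_mk, decide_eq_true_eq]
    generalize PowerSeries.coeff n p = c
    revert c
    decide

theorem one_add_X_mul_add_bijective (c : PowerSeries (ZMod 2)) :
    Function.Bijective fun p : PowerSeries (ZMod 2) => (1 + PowerSeries.X) * p + c := by
  have hu : IsUnit (1 + PowerSeries.X : PowerSeries (ZMod 2)) := by
    simp [PowerSeries.isUnit_iff_constantCoeff]
  exact (AddGroup.addRight_bijective c).comp (IsUnit.isUnit_iff_mulLeft_bijective.mp hu)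

theorem bijective_of_PhiPS_eq {f : (ℕ → Bool) → ℕ → Bool} (c : PowerSeries (ZMod 2))
    (hf : ∀ w, PhiPS (f w) = (1 + PowerSeries.X) * PhiPS w + c) : Function.Bijective f := by
  rw [← PhiPS_bijective.of_comp_iff' f, show PhiPS ∘ f = _ from funext hf]
  exact (one_add_X_mul_add_bijective c).comp PhiPS_bijective

/-- For the unique maps `a, b` with `a(0w) = 1·b(w)`, `a(1w) = 0·a(w)`, `b(0w) = 0·b(w)`,
`b(1w) = 1·a(w)`: both are bijections, `Φ(a(w)) = (1+t)Φ(w) + 1` and `Φ(b(w)) = (1+t)Φ(w)`;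
equivalently `Φ(a(b⁻¹(w))) = Φ(w) + 1` and `Φ(b(w)) = (1+t)Φ(w)`. -/
theorem lamplighter_generators_powerseries
    (a b : (ℕ → Bool) → (ℕ → Bool))
    (ha0 : ∀ w, a (cns false w) = cns true (b w))
    (ha1 : ∀ w, a (cns true w) = cns false (a w))
    (hb0 : ∀ w, b (cns false w) = cns false (b w))
    (hb1 : ∀ w, b (cns true w) = cns true (a w)) :
    Function.Bijective a ∧ Function.Bijective b ∧
    (∀ w, PhiPS (a w) = (1 + PowerSeries.X) * PhiPS w + 1) ∧
    (∀ w, PhiPS (b w) = (1 + PowerSeries.X) * PhiPS w) ∧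
    (∀ w, PhiPS (a (Function.invFun b w)) = PhiPS w + 1) := by
  have key : ∀ n w,
      PowerSeries.coeff n (PhiPS (a w)) =
        PowerSeries.coeff n ((1 + PowerSeries.X) * PhiPS w + 1) ∧
      PowerSeries.coeff n (PhiPS (b w)) = PowerSeries.coeff n ((1 + PowerSeries.X) * PhiPS w) := by
    intro n
    induction n with
    | zero =>
      intro w
      rw [← cns_head_tail w]
      generalize (fun n => w (n + 1)) = v
      cases w 0 <;> simp [ha0, ha1, hb0, hb1, PhiPS_cns, CharTwo.add_self_eq_zero]
    | succ n ih =>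
      intro w
      rw [← cns_head_tail w]
      generalize (fun n => w (n + 1)) = v
      obtain ⟨iha, ihb⟩ := ih v
      cases w 0
      · rw [ha0, hb0, PhiPS_cns, PhiPS_cns, PhiPS_cns]
        rw [show (1 + PowerSeries.X) * ((if false = true then 1 else 0) +
            PowerSeries.X * PhiPS v) = PowerSeries.X * ((1 + PowerSeries.X) * PhiPS v) by
          simp; ring]
        simp [PowerSeries.coeff_succ_X_mul, ihb, add_comm]
      · rw [ha1, hb1, PhiPS_cns, PhiPS_cns, PhiPS_cns]
        rw [show (1 + PowerSeries.X) * ((if true = true then 1 else 0) +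
            PowerSeries.X * PhiPS v) =
            1 + PowerSeries.X * ((1 + PowerSeries.X) * PhiPS v + 1) by
          simp; ring]
        simp only [if_true, map_add, PowerSeries.coeff_succ_X_mul, iha]
        simp [PowerSeries.coeff_one]
  have hA : ∀ w, PhiPS (a w) = (1 + PowerSeries.X) * PhiPS w + 1 :=
    fun w => PowerSeries.ext fun n => (key n w).1
  have hB : ∀ w, PhiPS (b w) = (1 + PowerSeries.X) * PhiPS w :=
    fun w => PowerSeries.ext fun n => (key n w).2
  have hb : Function.Bijective b := bijective_of_PhiPS_eq 0 (by simpa using hB)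
  refine ⟨bijective_of_PhiPS_eq 1 hA, hb, hA, hB, fun w => ?_⟩
  rw [hA, ← hB, Function.rightInverse_invFun hb.surjective]
end

section
/- Let a, b : {0,1}^ω → {0,1}^ω be the unique maps satisfying a(0w) = 1·b(w), a(1w) = 0·a(w), b(0w) = 0·b(w), b(1w) = 1·a(w) for all w ∈ {0,1}^ω. Then the group of bijections of {0,1}^ω generated by a and b is isomorphic to the lamplighter group (ℤ/2ℤ) ≀ ℤ, i.e. to the semidirect product (⊕_{i∈ℤ} ℤ/2ℤ) ⋊ ℤ in which the generator of ℤ acts on the restricted direct sum ⊕_{i∈ℤ} ℤ/2ℤ by shifting the coordinates. -/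
/-- The shift automorphism of `⊕_{i∈ℤ} ℤ/2ℤ` (finitely supported functions `ℤ → ℤ/2ℤ`),
sending `f` to `i ↦ f (i − 1)`. -/
noncomputable def lampShift : AddAut (ℤ →₀ ZMod 2) :=
  Finsupp.domCongr (Equiv.addRight (1 : ℤ))

/-- The action of `ℤ` on `⊕_{i∈ℤ} ℤ/2ℤ` by iterating the shift. -/
noncomputable def lampActionHom :
    Multiplicative ℤ →* MulAut (Multiplicative (ℤ →₀ ZMod 2)) :=
  zpowersHom _ (AddEquiv.toMultiplicative lampShift)

/-- The lamplighter group `(ℤ/2ℤ) ≀ ℤ = (⊕_{i∈ℤ} ℤ/2ℤ) ⋊ ℤ`, with the generator of `ℤ`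
acting by shifting coordinates. -/
noncomputable abbrev Lamplighter :=
  SemidirectProduct (Multiplicative (ℤ →₀ ZMod 2)) (Multiplicative ℤ) lampActionHom

open PowerSeries in
theorem isUnit_one_add_X : IsUnit (1 + X : PowerSeries (ZMod 2)) := by
  rw [PowerSeries.isUnit_iff_constantCoeff]
  simp

/-- The unit `1 + X` of `𝔽₂⟦X⟧`. -/
noncomputable def oneAddX : (PowerSeries (ZMod 2))ˣ := isUnit_one_add_X.unit

theorem oneAddX_val : (oneAddX : PowerSeries (ZMod 2)) = 1 + PowerSeries.X := rfl

/-- The linear map `𝔽₂[u, u⁻¹] → 𝔽₂⟦X⟧` substituting `1 + X` for `u`. -/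
noncomputable def lampSeries : (ℤ →₀ ZMod 2) →ₗ[ZMod 2] PowerSeries (ZMod 2) :=
  Finsupp.linearCombination (ZMod 2)
    (fun i : ℤ => ((oneAddX ^ i : (PowerSeries (ZMod 2))ˣ) : PowerSeries (ZMod 2)))

theorem lampSeries_single (i : ℤ) (c : ZMod 2) :
    lampSeries (Finsupp.single i c) =
      c • ((oneAddX ^ i : (PowerSeries (ZMod 2))ˣ) : PowerSeries (ZMod 2)) := by
  simp [lampSeries]

theorem lampShift_single (i : ℤ) (c : ZMod 2) :
    lampShift (Finsupp.single i c) = Finsupp.single (i + 1) c := by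
  simp [lampShift, Finsupp.equivMapDomain_single]

theorem lampSeries_lampShift (f : ℤ →₀ ZMod 2) :
    lampSeries (lampShift f) = oneAddX * lampSeries f := by
  induction f using Finsupp.induction_linear with
  | zero => simp
  | add f g hf hg => simp [hf, hg, mul_add]
  | single i c =>
    rw [lampShift_single, lampSeries_single, lampSeries_single, zpow_add_one, mul_comm (oneAddX ^ i)]
    simp

theorem lampSeries_lampActionHom (n : ℤ) (f : ℤ →₀ ZMod 2) :
    lampSeries (lampActionHom (Multiplicative.ofAdd n) (Multiplicative.ofAdd f)).toAdd =
      ((oneAddX ^ n : (PowerSeries (ZMod 2))ˣ) : PowerSeries (ZMod 2)) * lampSeries f := by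
  have key (g : ℤ →₀ ZMod 2) (m : ℤ) :
      lampActionHom (Multiplicative.ofAdd (m + 1)) (Multiplicative.ofAdd g) =
        lampActionHom (Multiplicative.ofAdd m) (Multiplicative.ofAdd (lampShift g)) := by
    rw [ofAdd_add, map_mul]
    simp [lampActionHom, zpowersHom_apply]
  induction n generalizing f with
  | zero => simp
  | succ n ih =>
    rw [key, ih, lampSeries_lampShift, zpow_add_one, Units.val_mul, mul_assoc]
  | pred n ih =>
    have h := key (lampShift.symm f) (-(n : ℤ) - 1)
    have h' := lampSeries_lampShift (lampShift.symm f)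
    rw [AddEquiv.apply_symm_apply] at h h'
    rw [← h, sub_add_cancel, ih, h', zpow_sub_one, Units.val_mul, mul_assoc,
      Units.inv_mul_cancel_left]

open Polynomial in
theorem lampSeries_injective : Function.Injective lampSeries := by
  rw [injective_iff_map_eq_zero]
  intro f hf
  obtain ⟨N, hN⟩ : ∃ N : ℕ, ∀ i ∈ f.support, 0 ≤ i + N := by
    refine ⟨∑ i ∈ f.support, i.natAbs, fun i hi => ?_⟩
    have := Finset.single_le_sum (f := Int.natAbs) (fun _ _ => Nat.zero_le _) hi
    omega
  have hinj : Set.InjOn (fun i : ℤ => (i + N).toNat) f.support := by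
    intro i hi j hj hij
    have := hN i hi
    have := hN j hj
    simp only at hij
    omega
  let p : (ZMod 2)[X] := ∑ i ∈ f.support, C (f i) * X ^ (i + N).toNat
  have hp : ((p.comp (1 + X) : (ZMod 2)[X]) : PowerSeries (ZMod 2)) =
      (oneAddX ^ N : (PowerSeries (ZMod 2))ˣ) * lampSeries f := by
    rw [lampSeries, Finsupp.linearCombination_apply, Finsupp.sum, Finset.mul_sum,
      Polynomial.sum_comp, ← Polynomial.coeToPowerSeries.ringHom_apply, map_sum]
    refine Finset.sum_congr rfl fun i hi => ?_
    have h : (oneAddX ^ N : (PowerSeries (ZMod 2))ˣ) * oneAddX ^ i = oneAddX ^ (i + N).toNat := by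
      rw [← zpow_natCast, ← zpow_natCast, ← zpow_add, Int.toNat_of_nonneg (hN i hi), add_comm]
    rw [mul_smul_comm, ← Units.val_mul, h]
    simp [oneAddX_val, PowerSeries.smul_eq_C_mul]
  rw [hf, mul_zero, Polynomial.coe_eq_zero_iff] at hp
  have hp0 : p = 0 := by
    have h := congrArg (fun q : (ZMod 2)[X] => q.comp (X - 1)) hp
    simpa [Polynomial.comp_assoc] using h
  ext i
  by_contra hi
  have hi' : i ∈ f.support := Finsupp.mem_support_iff.2 hi
  apply hi
  have h := congrArg (fun q : (ZMod 2)[X] => q.coeff (i + N).toNat) hp0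
  simp only [p, finsetSum_coeff, coeff_C_mul, coeff_X_pow, coeff_zero] at h
  rw [Finset.sum_eq_single_of_mem i hi'] at h
  · simpa using h
  · intro j hj hji
    rw [if_neg fun h => hji (hinj hj hi' h.symm), mul_zero]

/-- Translations of `𝔽₂⟦X⟧` by Laurent polynomials in `1 + X`. -/
noncomputable def lampTranslation :
    Multiplicative (ℤ →₀ ZMod 2) →* Equiv.Perm (PowerSeries (ZMod 2)) where
  toFun f := Equiv.addLeft (lampSeries f.toAdd)
  map_one' := by ext1; simp
  map_mul' f g := by ext1; simp

/-- Multiplications by powers of `1 + X` on `𝔽₂⟦X⟧`. -/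
noncomputable def lampScaling : Multiplicative ℤ →* Equiv.Perm (PowerSeries (ZMod 2)) :=
  (MulAction.toPermHom (PowerSeries (ZMod 2))ˣ (PowerSeries (ZMod 2))).comp
    (zpowersHom _ oneAddX)

theorem lampTranslation_apply (f : Multiplicative (ℤ →₀ ZMod 2)) (x : PowerSeries (ZMod 2)) :
    lampTranslation f x = lampSeries f.toAdd + x := rfl

theorem lampScaling_apply (n : Multiplicative ℤ) (x : PowerSeries (ZMod 2)) :
    lampScaling n x = (oneAddX ^ n.toAdd : (PowerSeries (ZMod 2))ˣ) * x := rfl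

/-- The lamplighter group acting on `𝔽₂⟦X⟧` by affine maps. -/
noncomputable def lampAffine : Lamplighter →* Equiv.Perm (PowerSeries (ZMod 2)) :=
  SemidirectProduct.lift lampTranslation lampScaling fun n => by
    refine MonoidHom.ext fun f => ?_
    suffices lampTranslation (lampActionHom n f) * lampScaling n =
        lampScaling n * lampTranslation f by
      simpa [eq_mul_inv_iff_mul_eq] using this
    ext1 x
    have h := lampSeries_lampActionHom n.toAdd f.toAdd
    rw [ofAdd_toAdd, ofAdd_toAdd] at h
    simp only [Equiv.Perm.mul_apply, lampTranslation_apply, lampScaling_apply, h, mul_add]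

theorem lampAffine_apply (g : Lamplighter) (x : PowerSeries (ZMod 2)) :
    lampAffine g x = lampSeries g.left.toAdd +
      (oneAddX ^ g.right.toAdd : (PowerSeries (ZMod 2))ˣ) * x := rfl

theorem lampAffine_injective : Function.Injective lampAffine := by
  rw [injective_iff_map_eq_one]
  intro g hg
  have h (x) : lampSeries g.left.toAdd +
      (oneAddX ^ g.right.toAdd : (PowerSeries (ZMod 2))ˣ) * x = x := by
    rw [← lampAffine_apply, hg, Equiv.Perm.one_apply]
  have h0 : lampSeries g.left.toAdd = 0 := by simpa using h 0
  have h1 : lampSeries (Finsupp.single g.right.toAdd 1) = lampSeries (Finsupp.single 0 1) := by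
    simpa [lampSeries_single, h0] using h 1
  ext1
  · exact (map_eq_zero_iff _ lampSeries_injective).1 h0
  · exact Finsupp.single_left_injective one_ne_zero (lampSeries_injective h1)

theorem lampAffine_range :
    lampAffine.range = Subgroup.closure
      {lampAffine (SemidirectProduct.inl (Multiplicative.ofAdd (Finsupp.single 0 1))) *
        lampAffine (SemidirectProduct.inr (Multiplicative.ofAdd 1)),
       lampAffine (SemidirectProduct.inr (Multiplicative.ofAdd 1))} := by
  set s := lampAffine (SemidirectProduct.inl (Multiplicative.ofAdd (Finsupp.single 0 1))) with hs
  set t := lampAffine (SemidirectProduct.inr (Multiplicative.ofAdd 1)) with ht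
  apply le_antisymm
  · have hst : s * t ∈ Subgroup.closure {s * t, t} := Subgroup.subset_closure (by simp)
    have htm : t ∈ Subgroup.closure {s * t, t} := Subgroup.subset_closure (by simp)
    have hsm : s ∈ Subgroup.closure {s * t, t} := by
      simpa using mul_mem hst (inv_mem htm)
    have hpow (n : Multiplicative ℤ) : lampAffine (SemidirectProduct.inr n) = t ^ n.toAdd := by
      rw [ht, ← map_zpow, ← map_zpow, ← ofAdd_zsmul, smul_eq_mul, mul_one, ofAdd_toAdd]
    have hinl (f : ℤ →₀ ZMod 2) : lampAffine (SemidirectProduct.inl (Multiplicative.ofAdd f)) ∈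
        Subgroup.closure {s * t, t} := by
      induction f using Finsupp.induction_linear with
      | zero => simp
      | add f g hf hg =>
        rw [ofAdd_add, map_mul, map_mul]
        exact mul_mem hf hg
      | single i c =>
        obtain rfl | rfl : c = 0 ∨ c = 1 := by revert c; decide
        · simp
        · have h : lampAffine (SemidirectProduct.inl (Multiplicative.ofAdd (Finsupp.single i 1))) =
              t ^ i * s * (t ^ i)⁻¹ := by
            rw [eq_mul_inv_iff_mul_eq, ← toAdd_ofAdd i, ← hpow]
            ext1 x
            simp [hs, lampAffine_apply, lampSeries_single, mul_add]
          rw [h]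
          exact mul_mem (mul_mem (zpow_mem htm i) hsm) (inv_mem (zpow_mem htm i))
    rintro _ ⟨g, rfl⟩
    rw [← SemidirectProduct.inl_left_mul_inr_right g, map_mul, hpow]
    exact mul_mem (hinl g.left.toAdd) (zpow_mem htm _)
  · rw [Subgroup.closure_le]
    rintro _ (rfl | rfl)
    · exact mul_mem ⟨_, rfl⟩ ⟨_, rfl⟩
    · exact ⟨_, rfl⟩

/-- Binary sequences as power series over `𝔽₂`. -/
noncomputable def seqEquiv : (ℕ → Bool) ≃ PowerSeries (ZMod 2) where
  toFun w := PowerSeries.mk fun n => if w n then 1 else 0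
  invFun p n := decide (PowerSeries.coeff n p = 1)
  left_inv w := by
    ext n
    cases h : w n <;> simp [h]
  right_inv p := by
    ext n
    rw [PowerSeries.coeff_mk]
    have h : ∀ c : ZMod 2, (if decide (c = 1) then 1 else 0 : ZMod 2) = c := by decide
    exact h _

theorem seqEquiv_cns (x : Bool) (w : ℕ → Bool) :
    seqEquiv (cns x w) = (if x then 1 else 0) + PowerSeries.X * seqEquiv w := by
  ext n
  cases n with
  | zero => cases x <;> simp [seqEquiv, cns]
  | succ n =>
    cases x <;> simp [seqEquiv, cns, PowerSeries.coeff_succ_X_mul, PowerSeries.coeff_one] <;> rfl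

theorem exists_eq_cns (w : ℕ → Bool) : ∃ x v, w = cns x v :=
  ⟨w 0, fun n => w (n + 1), by ext n; cases n <;> rfl⟩

theorem seqEquiv_automaton
    {a b : (ℕ → Bool) → (ℕ → Bool)}
    (ha0 : ∀ w, a (cns false w) = cns true (b w))
    (ha1 : ∀ w, a (cns true w) = cns false (a w))
    (hb0 : ∀ w, b (cns false w) = cns false (b w))
    (hb1 : ∀ w, b (cns true w) = cns true (a w)) (w : ℕ → Bool) :
    seqEquiv (a w) = 1 + (1 + PowerSeries.X) * seqEquiv w ∧
      seqEquiv (b w) = (1 + PowerSeries.X) * seqEquiv w := by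
  have two : (1 + 1 : PowerSeries (ZMod 2)) = 0 := by
    rw [← map_one PowerSeries.C, ← map_add, CharTwo.add_self_eq_zero, map_zero]
  suffices h : ∀ n w,
      PowerSeries.coeff n (seqEquiv (a w)) =
        PowerSeries.coeff n (1 + (1 + PowerSeries.X) * seqEquiv w) ∧
      PowerSeries.coeff n (seqEquiv (b w)) =
        PowerSeries.coeff n ((1 + PowerSeries.X) * seqEquiv w) from
    ⟨PowerSeries.ext fun n => (h n w).1, PowerSeries.ext fun n => (h n w).2⟩
  have step (n : ℕ) (c p q : PowerSeries (ZMod 2))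
      (h : ∀ m < n, PowerSeries.coeff m p = PowerSeries.coeff m q) :
      PowerSeries.coeff n (c + PowerSeries.X * p) =
        PowerSeries.coeff n (c + PowerSeries.X * q) := by
    cases n with
    | zero => simp
    | succ n => simp [PowerSeries.coeff_succ_X_mul, h n n.lt_succ_self]
  intro n
  induction n using Nat.strong_induction_on with
  | _ n ih =>
  intro w
  obtain ⟨x, v, rfl⟩ := exists_eq_cns w
  have hav := fun c => step n c _ _ fun m hm => (ih m hm v).1
  have hbv := fun c => step n c _ _ fun m hm => (ih m hm v).2
  cases x
  · rw [ha0, hb0]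
    simp only [seqEquiv_cns, hbv, if_true, Bool.false_eq_true, if_false]
    constructor <;> congr 1 <;> ring
  · rw [ha1, hb1]
    simp only [seqEquiv_cns, hav, if_true, Bool.false_eq_true, if_false]
    constructor <;> congr 1
    · linear_combination -two
    · ring

/-- The group of bijections of `{0,1}^ω` generated by the maps `a, b` determined by
`a(0w) = 1·b(w)`, `a(1w) = 0·a(w)`, `b(0w) = 0·b(w)`, `b(1w) = 1·a(w)` is isomorphic
to the lamplighter group `(ℤ/2ℤ) ≀ ℤ`. -/
theorem lamplighter_group_iso
    (a b : Equiv.Perm (ℕ → Bool))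
    (ha0 : ∀ w, a (cns false w) = cns true (b w))
    (ha1 : ∀ w, a (cns true w) = cns false (a w))
    (hb0 : ∀ w, b (cns false w) = cns false (b w))
    (hb1 : ∀ w, b (cns true w) = cns true (a w)) :
    Nonempty (↥(Subgroup.closure ({a, b} : Set (Equiv.Perm (ℕ → Bool)))) ≃* Lamplighter) := by
  let e : Equiv.Perm (PowerSeries (ZMod 2)) ≃* Equiv.Perm (ℕ → Bool) := seqEquiv.symm.permCongrHom
  have h := seqEquiv_automaton ha0 ha1 hb0 hb1
  have hb : e (lampAffine (SemidirectProduct.inr (Multiplicative.ofAdd 1))) = b := by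
    ext1 w
    apply seqEquiv.injective
    rw [(h w).2]
    simp [e, Equiv.permCongrHom, Equiv.permCongr_apply, lampAffine_apply, oneAddX_val]
  have ha : e (lampAffine (SemidirectProduct.inl (Multiplicative.ofAdd (Finsupp.single 0 1))) *
      lampAffine (SemidirectProduct.inr (Multiplicative.ofAdd 1))) = a := by
    ext1 w
    apply seqEquiv.injective
    rw [(h w).1]
    simp [e, Equiv.permCongrHom, Equiv.permCongr_apply, lampAffine_apply, oneAddX_val,
      lampSeries_single]
  have hrange : (e.toMonoidHom.comp lampAffine).range = Subgroup.closure {a, b} := by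
    rw [MonoidHom.range_comp, lampAffine_range, MonoidHom.map_closure, Set.image_pair]
    exact congrArg₂ (fun x y => Subgroup.closure {x, y}) ha hb
  have hinj : Function.Injective (e.toMonoidHom.comp lampAffine) :=
    e.injective.comp lampAffine_injective
  exact ⟨((MonoidHom.ofInjective hinj).trans (MulEquiv.subgroupCongr hrange)).symm⟩
end

section
/- Let a, b : {0,1}^ω → {0,1}^ω be the unique maps satisfying a(0w) = 1w, a(1w) = 0w, b(0w) = 0·a(w), b(1w) = 1·b(w) for all w ∈ {0,1}^ω. Then a and b are involutions, the product ab has infinite order, and the group of bijections of {0,1}^ω generated by a and b is isomorphic to the infinite dihedral group (equivalently, to the free product (ℤ/2ℤ) ∗ (ℤ/2ℤ)). -/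
/-- The homomorphism from the infinite dihedral group determined by two elements of order
dividing two: the rotation `r k` is sent to `(a * b) ^ k`. -/
def dihedralZeroLift {G : Type*} [Group G] (a b : G) (ha : a * a = 1) (hb : b * b = 1) :
    DihedralGroup 0 →* G :=
  have hconj : ∀ i : ℤ, (a * b) ^ i * a = a * (a * b) ^ (-i) := fun i => by
    have hainv : a⁻¹ = a := inv_eq_of_mul_eq_one_left ha
    have hbinv : b⁻¹ = b := inv_eq_of_mul_eq_one_left hb
    have h : SemiconjBy a (a * b)⁻¹ (a * b) := by
      simp [SemiconjBy, mul_assoc, hainv, hbinv]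
    rw [zpow_neg, ← inv_zpow]
    exact (h.zpow_right i).eq.symm
  { toFun := fun g => match g with
      | .r i => (a * b) ^ @id ℤ i
      | .sr i => a * (a * b) ^ @id ℤ i
    map_one' := zpow_zero (a * b)
    map_mul' := by
      rintro (i | i) (j | j) <;> change ℤ at i j
      · exact zpow_add (a * b) i j
      · change a * (a * b) ^ (j - i) = (a * b) ^ i * (a * (a * b) ^ j)
        rw [← mul_assoc, hconj, mul_assoc, ← zpow_add, neg_add_eq_sub]
      · change a * (a * b) ^ (i + j) = a * (a * b) ^ i * (a * b) ^ j
        rw [mul_assoc, ← zpow_add]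
      · change (a * b) ^ (j - i) = a * (a * b) ^ i * (a * (a * b) ^ j)
        rw [mul_assoc, ← mul_assoc _ a, hconj, mul_assoc, ← mul_assoc, ha, one_mul, ← zpow_add,
          neg_add_eq_sub] }

theorem range_dihedralZeroLift {G : Type*} [Group G] (a b : G) (ha : a * a = 1)
    (hb : b * b = 1) : (dihedralZeroLift a b ha hb).range = Subgroup.closure {a, b} := by
  have hmem_a : a ∈ Subgroup.closure {a, b} := Subgroup.subset_closure (by simp)
  have hmem_b : b ∈ Subgroup.closure {a, b} := Subgroup.subset_closure (by simp)
  apply le_antisymm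
  · rintro _ ⟨i | i, rfl⟩
    · exact zpow_mem (mul_mem hmem_a hmem_b) _
    · exact mul_mem hmem_a (zpow_mem (mul_mem hmem_a hmem_b) _)
  · rw [Subgroup.closure_le]
    rintro x (rfl | rfl)
    · refine ⟨.sr 0, ?_⟩
      change x * (x * b) ^ (0 : ℤ) = x
      simp
    · refine ⟨.sr 1, ?_⟩
      change a * (a * x) ^ (1 : ℤ) = x
      rw [zpow_one, ← mul_assoc, ha, one_mul]

theorem dihedralZeroLift_injective {G : Type*} [Group G] (a b : G) (ha : a * a = 1)
    (hb : b * b = 1) (ha1 : a ≠ 1) (hab : ∀ n : ℕ, 0 < n → (a * b) ^ n ≠ 1) :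
    Function.Injective (dihedralZeroLift a b ha hb) := by
  have hinj : Function.Injective fun k : ℤ => (a * b) ^ k := by
    rw [injective_zpow_iff_not_isOfFinOrder, isOfFinOrder_iff_pow_eq_one]
    rintro ⟨n, hn, h⟩
    exact hab n hn h
  rw [injective_iff_map_eq_one]
  rintro (i | i) h <;> change ℤ at i
  · change (a * b) ^ i = 1 at h
    have hi : i = 0 := hinj (h.trans (zpow_zero _).symm)
    exact congrArg DihedralGroup.r hi
  · change a * (a * b) ^ i = 1 at h
    have hai : (a * b) ^ i = a :=
      (eq_inv_of_mul_eq_one_right h).trans (inv_eq_of_mul_eq_one_left ha)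
    have hi : i + i = 0 := hinj <| by
      change (a * b) ^ (i + i) = (a * b) ^ (0 : ℤ)
      rw [zpow_add, hai, ha, zpow_zero]
    have hi0 : i = 0 := by omega
    exact absurd (by rw [← hai, hi0, zpow_zero]) ha1

theorem cns_inj {x y : Bool} {v w : ℕ → Bool} : cns x v = cns y w ↔ x = y ∧ v = w := by
  refine ⟨fun h => ⟨congrFun h 0, funext fun n => congrFun h (n + 1)⟩, ?_⟩
  rintro ⟨rfl, rfl⟩
  rfl


/-- For the unique maps `a, b` with `a(0w) = 1w`, `a(1w) = 0w`, `b(0w) = 0·a(w)`,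
`b(1w) = 1·b(w)`: `a` and `b` are involutions, `ab` has infinite order, and the group
they generate is isomorphic to the infinite dihedral group `(ℤ/2ℤ) ∗ (ℤ/2ℤ)`. -/
theorem infinite_dihedral_selfsimilar
    (a b : Equiv.Perm (ℕ → Bool))
    (ha0 : ∀ w, a (cns false w) = cns true w)
    (ha1 : ∀ w, a (cns true w) = cns false w)
    (hb0 : ∀ w, b (cns false w) = cns false (a w))
    (hb1 : ∀ w, b (cns true w) = cns true (b w)) :
    a ^ 2 = 1 ∧ b ^ 2 = 1 ∧ a ≠ 1 ∧ b ≠ 1 ∧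
    (∀ n : ℕ, 0 < n → (a * b) ^ n ≠ 1) ∧
    Nonempty (↥(Subgroup.closure ({a, b} : Set (Equiv.Perm (ℕ → Bool)))) ≃* DihedralGroup 0) := by
  have haa : ∀ w, a (a w) = w := fun w => by
    obtain ⟨x, v, rfl⟩ := exists_eq_cns w
    cases x <;> simp [ha0, ha1]
  have hbb : ∀ w, b (b w) = w := fun w => by
    funext n
    induction n generalizing w with
    | zero =>
      obtain ⟨x, v, rfl⟩ := exists_eq_cns w
      cases x <;> simp [hb0, hb1, cns]
    | succ n ih =>
      obtain ⟨x, v, rfl⟩ := exists_eq_cns w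
      cases x <;> simp [hb0, hb1, haa, cns, ih]
  have ha2 : a * a = 1 := Equiv.ext haa
  have hb2 : b * b = 1 := Equiv.ext hbb
  have hane : a ≠ 1 := fun h => by
    have h0 := ha0 fun _ => false
    simp [h, cns_inj] at h0
  have hbne : b ≠ 1 := fun h => hane <| Equiv.ext fun w => by
    have h0 := hb0 w
    rw [h, Equiv.Perm.one_apply, cns_inj] at h0
    exact h0.2.symm
  have hsq : ∀ (k : ℕ) (w : ℕ → Bool),
      ((a * b) ^ (2 * k)) (cns true w) = cns true (((a * b) ^ k) w) := by
    intro k w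
    induction k with
    | zero => rfl
    | succ k ih =>
      rw [Nat.mul_succ, Nat.add_comm, pow_add, Equiv.Perm.mul_apply, ih, pow_succ' _ k]
      simp [pow_two, ha0, ha1, hb0, hb1]
  have hord : ∀ n : ℕ, 0 < n → (a * b) ^ n ≠ 1 := by
    intro n
    induction n using Nat.strong_induction_on with
    | _ n ih =>
      intro hn h
      obtain ⟨k, rfl | rfl⟩ := Nat.even_or_odd' n
      · refine ih k (by omega) (by omega) (Equiv.ext fun w => ?_)
        have hw := hsq k w
        rw [h, Equiv.Perm.one_apply, cns_inj] at hw
        exact hw.2.symm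
      · have hw : ((a * b) ^ (2 * k + 1)) (cns true fun _ => false) =
            cns false (b (((a * b) ^ k) fun _ => false)) := by
          rw [pow_succ', Equiv.Perm.mul_apply, hsq, Equiv.Perm.mul_apply, hb1, ha1]
        simp [h, cns_inj] at hw
  refine ⟨(pow_two a).trans ha2, (pow_two b).trans hb2, hane, hbne, hord, ?_⟩
  rw [← range_dihedralZeroLift a b ha2 hb2]
  exact ⟨(MonoidHom.ofInjective (dihedralZeroLift_injective a b ha2 hb2 hane hord)).symm⟩
end

section
/- The Grigorchuk group 𝐆 is infinite, and it is a torsion 2-group: for every g ∈ 𝐆 there exists n ∈ ℕ such that g^{2^n} = 1. In particular 𝐆 is an infinite finitely generated torsion group. -/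
/-- The permutations `a, b, c, d` of binary sequences satisfy the recursions defining the
generators of the Grigorchuk group. -/
structure IsGrigorchukSystem (a b c d : Equiv.Perm (ℕ → Bool)) : Prop where
  a_false : ∀ w, a (cns false w) = cns true w
  a_true : ∀ w, a (cns true w) = cns false w
  b_false : ∀ w, b (cns false w) = cns false (a w)
  b_true : ∀ w, b (cns true w) = cns true (c w)
  c_false : ∀ w, c (cns false w) = cns false (a w)
  c_true : ∀ w, c (cns true w) = cns true (d w)
  d_false : ∀ w, d (cns false w) = cns false w
  d_true : ∀ w, d (cns true w) = cns true (b w)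

/-- `KleinWeight b c d n x` says that `x` is one of `1, b, c, d`, of weight `n = 0, 3, 2, 1`
respectively. -/
inductive KleinWeight {G : Type*} [Group G] (b c d : G) : ℕ → G → Prop
  | one : KleinWeight b c d 0 1
  | b : KleinWeight b c d 3 b
  | c : KleinWeight b c d 2 c
  | d : KleinWeight b c d 1 d

/-- `AltWeight a b c d n g` says that `g` is a product of factors `a * x` with
`x ∈ {1, b, c, d}`, of total weight `n`, where `a` has weight `3`. -/
inductive AltWeight {G : Type*} [Group G] (a b c d : G) : ℕ → G → Prop
  | one : AltWeight a b c d 0 1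
  | step {n m : ℕ} {g x : G} : AltWeight a b c d n g → KleinWeight b c d m x →
      AltWeight a b c d (n + (3 + m)) (g * (a * x))

/-- `WordWeight a b c d n g` says that `g` is the value of an alternating word in `a` and
`{1, b, c, d}` of weight at most `n`. -/
def WordWeight {G : Type*} [Group G] (a b c d : G) (n : ℕ) (g : G) : Prop :=
  ∃ m k x h, KleinWeight b c d m x ∧ AltWeight a b c d k h ∧ m + k ≤ n ∧ g = x * h

theorem cns_zero (x : Bool) (w : ℕ → Bool) : cns x w 0 = x := rfl

theorem cns_succ (x : Bool) (w : ℕ → Bool) (n : ℕ) : cns x w (n + 1) = w n := rfl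

theorem cns_right_injective (x : Bool) : Function.Injective (cns x) := by
  intro v w h
  funext n
  exact congrFun h (n + 1)

theorem forall_cns {P : (ℕ → Bool) → Prop} (h : ∀ x w, P (cns x w)) (w : ℕ → Bool) : P w := by
  rw [← cns_head_tail w]
  exact h _ _

namespace IsGrigorchukSystem

variable {a b c d : Equiv.Perm (ℕ → Bool)}

theorem a_mul_a (h : IsGrigorchukSystem a b c d) : a * a = 1 := by
  refine Equiv.ext (forall_cns fun x w => ?_)
  cases x <;> simp [h.a_false, h.a_true]

theorem klein_relations (h : IsGrigorchukSystem a b c d) :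
    b * b = 1 ∧ c * c = 1 ∧ d * d = 1 ∧ b * c = d ∧ c * d = b ∧ d * b = c := by
  have ha : ∀ w, a (a w) = w := fun w => congrArg (fun g : Equiv.Perm _ => g w) h.a_mul_a
  have key : ∀ n w, b (b w) n = w n ∧ c (c w) n = w n ∧ d (d w) n = w n ∧
      b (c w) n = d w n ∧ c (d w) n = b w n ∧ d (b w) n = c w n := by
    intro n
    induction n with
    | zero =>
      refine forall_cns fun x w => ?_
      cases x <;> simp [h.b_false, h.b_true, h.c_false, h.c_true, h.d_false, h.d_true, cns_zero]
    | succ n ih =>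
      refine forall_cns fun x w => ?_
      obtain ⟨h1, h2, h3, h4, h5, h6⟩ := ih w
      cases x <;> simp [h.b_false, h.b_true, h.c_false, h.c_true, h.d_false, h.d_true, cns_succ,
        *]
  refine ⟨?_, ?_, ?_, ?_, ?_, ?_⟩ <;> ext w n <;> simp [key n w]

end IsGrigorchukSystem

section Words

variable {G : Type*} [Group G] {a b c d : G}

theorem KleinWeight.mul (hb : b * b = 1) (hc : c * c = 1) (hd : d * d = 1)
    (hbc : b * c = d) (hcd : c * d = b) (hdb : d * b = c) {m n : ℕ} {x y : G}
    (hx : KleinWeight b c d m x) (hy : KleinWeight b c d n y) :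
    ∃ l ≤ m + n, KleinWeight b c d l (x * y) := by
  have hcb : c * b = d := by rw [← hcd, ← mul_assoc, hc, one_mul]
  have hdc : d * c = b := by rw [← hdb, ← mul_assoc, hd, one_mul]
  have hbd : b * d = c := by rw [← hbc, ← mul_assoc, hb, one_mul]
  cases hx <;> cases hy <;>
    simp only [one_mul, mul_one, hb, hc, hd, hbc, hcd, hdb, hcb, hdc, hbd] <;>
    first
    | exact ⟨0, by omega, .one⟩
    | exact ⟨3, by omega, .b⟩
    | exact ⟨2, by omega, .c⟩
    | exact ⟨1, by omega, .d⟩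

theorem KleinWeight.sq (hb : b * b = 1) (hc : c * c = 1) (hd : d * d = 1) {m : ℕ} {x : G}
    (hx : KleinWeight b c d m x) : x ^ 2 = 1 := by
  cases hx <;> simp [pow_two, *]

theorem AltWeight.mul {m n : ℕ} {g h : G} (hg : AltWeight a b c d m g)
    (hh : AltWeight a b c d n h) : AltWeight a b c d (m + n) (g * h) := by
  induction hh with
  | one => simpa using hg
  | step _ hx ih =>
    rw [← add_assoc, ← mul_assoc]
    exact ih.step hx

/-- A Klein factor on the right of an alternating product is absorbed, unless the product is
empty. -/
theorem AltWeight.mul_klein (hb : b * b = 1) (hc : c * c = 1) (hd : d * d = 1)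
    (hbc : b * c = d) (hcd : c * d = b) (hdb : d * b = c) {m n : ℕ} {g x : G}
    (hg : AltWeight a b c d n g) (hx : KleinWeight b c d m x) :
    g = 1 ∨ ∃ l, 0 < l ∧ l ≤ n + m ∧ AltWeight a b c d l (g * x) := by
  cases hg with
  | one => exact Or.inl rfl
  | step hg hy =>
    obtain ⟨l, hl, hyx⟩ := hy.mul hb hc hd hbc hcd hdb hx
    refine Or.inr ⟨_, ?_, ?_, by simpa only [mul_assoc] using hg.step hyx⟩ <;> omega

theorem KleinWeight.wordWeight {m : ℕ} {x : G} (hx : KleinWeight b c d m x) :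
    WordWeight a b c d m x :=
  ⟨m, 0, x, 1, hx, .one, by simp, by simp⟩

theorem wordWeight_generator : WordWeight a b c d 3 a :=
  ⟨0, 3, 1, a, .one, by simpa using AltWeight.step (a := a) .one .one, le_rfl, by simp⟩

theorem WordWeight.mul (hb : b * b = 1) (hc : c * c = 1) (hd : d * d = 1)
    (hbc : b * c = d) (hcd : c * d = b) (hdb : d * b = c) {m n : ℕ} {g h : G}
    (hg : WordWeight a b c d m g) (hh : WordWeight a b c d n h) :
    WordWeight a b c d (m + n) (g * h) := by
  obtain ⟨k, l, x, g, hx, hg, hkl, rfl⟩ := hg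
  obtain ⟨k', l', y, h, hy, hh, hkl', rfl⟩ := hh
  rcases hg.mul_klein hb hc hd hbc hcd hdb hy with rfl | ⟨r, -, hr, hgy⟩
  · obtain ⟨r, hr, hxy⟩ := hx.mul hb hc hd hbc hcd hdb hy
    exact ⟨r, l', x * y, h, hxy, hh, by omega, by simp [mul_assoc]⟩
  · exact ⟨k, r + l', x, g * y * h, hx, hgy.mul hh, by omega, by simp [mul_assoc]⟩

end Words

/-- `f` maps `0w` to `e·f₀(w)` and `1w` to `(1 - e)·f₁(w)`. -/
def HasSections (f : Equiv.Perm (ℕ → Bool)) (e : Bool) (f₀ f₁ : Equiv.Perm (ℕ → Bool)) : Prop :=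
  (∀ w, f (cns false w) = cns e (f₀ w)) ∧ ∀ w, f (cns true w) = cns (!e) (f₁ w)

theorem HasSections.pow {f f₀ f₁ : Equiv.Perm (ℕ → Bool)} (hf : HasSections f false f₀ f₁)
    (n : ℕ) : HasSections (f ^ n) false (f₀ ^ n) (f₁ ^ n) := by
  induction n with
  | zero => exact ⟨fun _ => rfl, fun _ => rfl⟩
  | succ n ih =>
    refine ⟨fun w => ?_, fun w => ?_⟩
    · simp only [pow_succ, Equiv.Perm.mul_apply, hf.1, ih.1]
    · have h1 := ih.2
      have h2 := hf.2
      simp only [Bool.not_false] at h1 h2 ⊢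
      simp only [pow_succ, Equiv.Perm.mul_apply, h1, h2]

theorem HasSections.sq {f f₀ f₁ : Equiv.Perm (ℕ → Bool)} (hf : HasSections f true f₀ f₁) :
    HasSections (f ^ 2) false (f₁ * f₀) (f₀ * f₁) := by
  obtain ⟨h1, h2⟩ := hf
  simp only [Bool.not_true] at h2
  exact ⟨fun w => by simp [pow_two, h1, h2], fun w => by simp [pow_two, h1, h2]⟩

theorem pow_two_pow_eq_one_of_le {G : Type*} [Monoid G] {g : G} {m n : ℕ} (hmn : m ≤ n)
    (hg : g ^ 2 ^ m = 1) : g ^ 2 ^ n = 1 := by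
  obtain ⟨k, hk⟩ := pow_dvd_pow 2 hmn
  rw [hk, pow_mul, hg, one_pow]

theorem HasSections.exists_pow_eq_one {f f₀ f₁ : Equiv.Perm (ℕ → Bool)}
    (hf : HasSections f false f₀ f₁) (h₀ : ∃ n : ℕ, f₀ ^ 2 ^ n = 1)
    (h₁ : ∃ n : ℕ, f₁ ^ 2 ^ n = 1) : ∃ n : ℕ, f ^ 2 ^ n = 1 := by
  obtain ⟨m, hm⟩ := h₀
  obtain ⟨n, hn⟩ := h₁
  refine ⟨max m n, Equiv.ext (forall_cns fun x w => ?_)⟩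
  have h := hf.pow (2 ^ max m n)
  rw [pow_two_pow_eq_one_of_le (le_max_left m n) hm,
    pow_two_pow_eq_one_of_le (le_max_right m n) hn] at h
  cases x
  · exact h.1 w
  · exact h.2 w

namespace IsGrigorchukSystem

variable {a b c d : Equiv.Perm (ℕ → Bool)}

/-- If `x ∈ {1, b, c, d}` has weight `m`, the sections of `a * x` have total weight at most
`2 + m`, which is less than the weight of `a * x`. -/
theorem exists_sections_step (h : IsGrigorchukSystem a b c d) {m : ℕ}
    {x : Equiv.Perm (ℕ → Bool)} (hx : KleinWeight b c d m x) :
    ∃ f₀ f₁ n₀ n₁, HasSections (a * x) true f₀ f₁ ∧ WordWeight a b c d n₀ f₀ ∧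
      WordWeight a b c d n₁ f₁ ∧ n₀ + n₁ ≤ 2 + m := by
  cases hx with
  | one =>
    exact ⟨1, 1, 0, 0, ⟨fun w => by simp [h.a_false], fun w => by simp [h.a_true]⟩,
      KleinWeight.one.wordWeight, KleinWeight.one.wordWeight, by omega⟩
  | b =>
    exact ⟨a, c, 3, 2, ⟨fun w => by simp [h.a_false, h.b_false],
      fun w => by simp [h.a_true, h.b_true]⟩,
      wordWeight_generator, KleinWeight.c.wordWeight, by omega⟩
  | c =>
    exact ⟨a, d, 3, 1, ⟨fun w => by simp [h.a_false, h.c_false],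
      fun w => by simp [h.a_true, h.c_true]⟩,
      wordWeight_generator, KleinWeight.d.wordWeight, by omega⟩
  | d =>
    exact ⟨1, b, 0, 3, ⟨fun w => by simp [h.a_false, h.d_false],
      fun w => by simp [h.a_true, h.d_true]⟩,
      KleinWeight.one.wordWeight, KleinWeight.b.wordWeight, by omega⟩

theorem wordWeight_mul (h : IsGrigorchukSystem a b c d) {m n : ℕ}
    {f g : Equiv.Perm (ℕ → Bool)} (hf : WordWeight a b c d m f)
    (hg : WordWeight a b c d n g) : WordWeight a b c d (m + n) (f * g) := by
  obtain ⟨hb, hc, hd, hbc, hcd, hdb⟩ := h.klein_relations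
  exact hf.mul hb hc hd hbc hcd hdb hg

/-- The sections of a nonempty alternating product have smaller total weight. -/
theorem exists_sections (h : IsGrigorchukSystem a b c d) {n : ℕ}
    {f : Equiv.Perm (ℕ → Bool)} (hf : AltWeight a b c d n f) :
    ∃ e f₀ f₁ n₀ n₁, HasSections f e f₀ f₁ ∧ WordWeight a b c d n₀ f₀ ∧
      WordWeight a b c d n₁ f₁ ∧ n₀ + n₁ ≤ n - 1 := by
  induction hf with
  | one =>
    exact ⟨false, 1, 1, 0, 0, ⟨fun _ => rfl, fun _ => rfl⟩, KleinWeight.one.wordWeight,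
      KleinWeight.one.wordWeight, le_rfl⟩
  | step _ hx ih =>
    obtain ⟨e, f₀, f₁, n₀, n₁, hs, h₀, h₁, hn⟩ := ih
    obtain ⟨g₀, g₁, m₀, m₁, ht, k₀, k₁, hm⟩ := h.exists_sections_step hx
    obtain ⟨hs0, hs1⟩ := hs
    obtain ⟨ht0, ht1⟩ := ht
    simp only [Bool.not_true] at ht1
    refine ⟨!e, f₁ * g₀, f₀ * g₁, n₁ + m₀, n₀ + m₁, ⟨fun w => ?_, fun w => ?_⟩,
      h.wordWeight_mul h₁ k₀, h.wordWeight_mul h₀ k₁, by omega⟩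
    · rw [Equiv.Perm.mul_apply, ht0, hs1, Equiv.Perm.mul_apply]
    · rw [Equiv.Perm.mul_apply, ht1, hs0, Equiv.Perm.mul_apply, Bool.not_not]

theorem exists_pow_eq_one_of_wordWeight (h : IsGrigorchukSystem a b c d) (n : ℕ) :
    ∀ f, WordWeight a b c d n f → ∃ k : ℕ, f ^ 2 ^ k = 1 := by
  induction n using Nat.strong_induction_on with
  | _ n ih =>
  rintro _ ⟨m, k, x, f, hx, hf, hmk, rfl⟩
  obtain ⟨hb, hc, hd, hbc, hcd, hdb⟩ := h.klein_relations
  rcases hf.mul_klein hb hc hd hbc hcd hdb hx with rfl | ⟨l, hl0, hl, hfx⟩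
  · exact ⟨1, by simpa using hx.sq hb hc hd⟩
  have hconj : x * f = x * (f * x) * x⁻¹ := by group
  suffices ∃ k : ℕ, (f * x) ^ 2 ^ k = 1 by
    obtain ⟨k, hk⟩ := this
    exact ⟨k, by rw [hconj, conj_pow, hk, mul_one, mul_inv_cancel]⟩
  obtain ⟨e, f₀, f₁, n₀, n₁, hs, h₀, h₁, hn⟩ := h.exists_sections hfx
  cases e with
  | false => exact hs.exists_pow_eq_one (ih n₀ (by omega) _ h₀) (ih n₁ (by omega) _ h₁)
  | true =>
    obtain ⟨k, hk⟩ := hs.sq.exists_pow_eq_one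
      (ih (n₁ + n₀) (by omega) _ (h.wordWeight_mul h₁ h₀))
      (ih (n₀ + n₁) (by omega) _ (h.wordWeight_mul h₀ h₁))
    exact ⟨k + 1, by rw [pow_succ', pow_mul, hk]⟩

theorem exists_wordWeight (h : IsGrigorchukSystem a b c d) {g : Equiv.Perm (ℕ → Bool)}
    (hg : g ∈ Subgroup.closure ({a, b, c, d} : Set (Equiv.Perm (ℕ → Bool)))) :
    ∃ n, WordWeight a b c d n g := by
  obtain ⟨hb, hc, hd, -⟩ := h.klein_relations
  have hgen : ∀ x ∈ ({a, b, c, d} : Set (Equiv.Perm (ℕ → Bool))),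
      x⁻¹ = x ∧ ∃ n, WordWeight a b c d n x := by
    rintro x (rfl | rfl | rfl | rfl)
    · exact ⟨inv_eq_of_mul_eq_one_left h.a_mul_a, 3, wordWeight_generator⟩
    · exact ⟨inv_eq_of_mul_eq_one_left hb, 3, KleinWeight.b.wordWeight⟩
    · exact ⟨inv_eq_of_mul_eq_one_left hc, 2, KleinWeight.c.wordWeight⟩
    · exact ⟨inv_eq_of_mul_eq_one_left hd, 1, KleinWeight.d.wordWeight⟩
  induction hg using Subgroup.closure_induction_right with
  | one => exact ⟨0, KleinWeight.one.wordWeight⟩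
  | mul_right f _ x hx ih =>
    obtain ⟨m, hm⟩ := ih
    obtain ⟨n, hn⟩ := (hgen x hx).2
    exact ⟨m + n, h.wordWeight_mul hm hn⟩
  | mul_inv_cancel f _ x hx ih =>
    obtain ⟨m, hm⟩ := ih
    obtain ⟨hinv, n, hn⟩ := hgen x hx
    exact ⟨m + n, by rw [hinv]; exact h.wordWeight_mul hm hn⟩

/-- Every element of the group is the section at `0` of an element preserving the set
of sequences starting with `0`. -/
theorem exists_lift (h : IsGrigorchukSystem a b c d) {g : Equiv.Perm (ℕ → Bool)}
    (hg : g ∈ Subgroup.closure ({a, b, c, d} : Set (Equiv.Perm (ℕ → Bool)))) :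
    ∃ f ∈ Subgroup.closure ({a, b, c, d} : Set (Equiv.Perm (ℕ → Bool))),
      ∀ w, f (cns false w) = cns false (g w) := by
  have ha : a ∈ Subgroup.closure ({a, b, c, d} : Set (Equiv.Perm (ℕ → Bool))) :=
    Subgroup.subset_closure (by simp)
  have hb : b ∈ Subgroup.closure ({a, b, c, d} : Set (Equiv.Perm (ℕ → Bool))) :=
    Subgroup.subset_closure (by simp)
  have hc : c ∈ Subgroup.closure ({a, b, c, d} : Set (Equiv.Perm (ℕ → Bool))) :=
    Subgroup.subset_closure (by simp)
  have hd : d ∈ Subgroup.closure ({a, b, c, d} : Set (Equiv.Perm (ℕ → Bool))) :=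
    Subgroup.subset_closure (by simp)
  induction hg using Subgroup.closure_induction with
  | mem x hx =>
    rcases hx with rfl | rfl | rfl | rfl
    · exact ⟨b, hb, h.b_false⟩
    · exact ⟨a * d * a, mul_mem (mul_mem ha hd) ha, fun w => by
        simp [h.a_false, h.a_true, h.d_true]⟩
    · exact ⟨a * b * a, mul_mem (mul_mem ha hb) ha, fun w => by
        simp [h.a_false, h.a_true, h.b_true]⟩
    · exact ⟨a * c * a, mul_mem (mul_mem ha hc) ha, fun w => by
        simp [h.a_false, h.a_true, h.c_true]⟩
  | one => exact ⟨1, one_mem _, fun _ => rfl⟩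
  | mul x y _ _ hx hy =>
    obtain ⟨f, hf, hfx⟩ := hx
    obtain ⟨g, hg, hgy⟩ := hy
    exact ⟨f * g, mul_mem hf hg, fun w => by simp [hgy, hfx]⟩
  | inv x _ hx =>
    obtain ⟨f, hf, hfx⟩ := hx
    exact ⟨f⁻¹, inv_mem hf, fun w => by rw [Equiv.Perm.inv_eq_iff_eq, hfx]; simp⟩

theorem infinite_closure (h : IsGrigorchukSystem a b c d) :
    Infinite ↥(Subgroup.closure ({a, b, c, d} : Set (Equiv.Perm (ℕ → Bool)))) := by
  by_contra hfin
  rw [not_infinite_iff_finite] at hfin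
  choose lift hmem hlift using fun g : ↥(Subgroup.closure
    ({a, b, c, d} : Set (Equiv.Perm (ℕ → Bool)))) => h.exists_lift g.2
  have hinj : Function.Injective fun g : ↥(Subgroup.closure
      ({a, b, c, d} : Set (Equiv.Perm (ℕ → Bool)))) =>
      (⟨lift g, hmem g⟩ : ↥(Subgroup.closure ({a, b, c, d} : Set (Equiv.Perm (ℕ → Bool))))) := by
    intro f g hfg
    have hfg' : lift f = lift g := congrArg Subtype.val hfg
    refine Subtype.ext (Equiv.ext fun w => cns_right_injective false ?_)
    rw [← hlift, ← hlift, hfg']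
  obtain ⟨g, hg⟩ := Finite.injective_iff_surjective.mp hinj
    ⟨a, Subgroup.subset_closure (by simp)⟩
  have hga : lift g = a := congrArg Subtype.val hg
  have hw := hlift g fun _ => false
  rw [hga, h.a_false] at hw
  exact Bool.noConfusion (congrFun hw 0)

end IsGrigorchukSystem

/-- The Grigorchuk group (the group of bijections of `{0,1}^ω` generated by `a, b, c, d`
with `a(0w)=1w`, `a(1w)=0w`, `b(0w)=0·a(w)`, `b(1w)=1·c(w)`, `c(0w)=0·a(w)`, `c(1w)=1·d(w)`,
`d(0w)=0w`, `d(1w)=1·b(w)`) is infinite, and it is a torsion 2-group: every element `g`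
satisfies `g^(2^n) = 1` for some `n`. -/
theorem grigorchuk_infinite_torsion_two_group
    (a b c d : Equiv.Perm (ℕ → Bool))
    (ha0 : ∀ w, a (cns false w) = cns true w)
    (ha1 : ∀ w, a (cns true w) = cns false w)
    (hb0 : ∀ w, b (cns false w) = cns false (a w))
    (hb1 : ∀ w, b (cns true w) = cns true (c w))
    (hc0 : ∀ w, c (cns false w) = cns false (a w))
    (hc1 : ∀ w, c (cns true w) = cns true (d w))
    (hd0 : ∀ w, d (cns false w) = cns false w)
    (hd1 : ∀ w, d (cns true w) = cns true (b w)) :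
    Infinite ↥(Subgroup.closure ({a, b, c, d} : Set (Equiv.Perm (ℕ → Bool)))) ∧
    ∀ g ∈ Subgroup.closure ({a, b, c, d} : Set (Equiv.Perm (ℕ → Bool))),
      ∃ n : ℕ, g ^ (2 ^ n) = 1 := by
  have h : IsGrigorchukSystem a b c d := ⟨ha0, ha1, hb0, hb1, hc0, hc1, hd0, hd1⟩
  refine ⟨h.infinite_closure, fun g hg => ?_⟩
  obtain ⟨n, hn⟩ := h.exists_wordWeight hg
  exact h.exists_pow_eq_one_of_wordWeight n g hn
end

section
/- Let γ(n) denote the growth function of the Grigorchuk group 𝐆 with respect to the generating set {a,b,c,d}, i.e. γ(n) is the number of elements of 𝐆 expressible as a product of at most n generators. Then 𝐆 has intermediate growth, with the explicit bounds e^{n^{0.5157}} ≼ γ(n) ≼ e^{n^{0.7675}}: there is a constant C ≥ 1 such that for all sufficiently large n one has exp(n^{0.5157}) ≤ γ(Cn) and γ(n) ≤ exp((Cn)^{0.7675}). In particular γ grows faster than every polynomial and slower than every exponential function b^n with b > 1. -/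
open Filter

/-- The growth function of a group of permutations with respect to a generating set `S`:
`growthFn S n` is the number of elements expressible as a product of at most `n`
elements of `S`. -/
noncomputable def growthFn (S : Set (Equiv.Perm (ℕ → Bool))) (n : ℕ) : ℕ :=
  Nat.card {g : Equiv.Perm (ℕ → Bool) |
    ∃ l : List (Equiv.Perm (ℕ → Bool)), l.length ≤ n ∧ (∀ x ∈ l, x ∈ S) ∧ l.prod = g}

namespace Grigorchuk

open Equiv (Perm)

/-- The recursions defining the four standard generators of the Grigorchuk group. -/
structure IsGenerators (a b c d : Perm (ℕ → Bool)) : Prop where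
  a0 : ∀ w, a (cns false w) = cns true w
  a1 : ∀ w, a (cns true w) = cns false w
  b0 : ∀ w, b (cns false w) = cns false (a w)
  b1 : ∀ w, b (cns true w) = cns true (c w)
  c0 : ∀ w, c (cns false w) = cns false (a w)
  c1 : ∀ w, c (cns true w) = cns true (d w)
  d0 : ∀ w, d (cns false w) = cns false w
  d1 : ∀ w, d (cns true w) = cns true (b w)

/-- `Dec g s g₀ g₁`: the permutation `g` acts on the first letter by adding `s`, and has
sections `g₀`, `g₁` at the letters `0`, `1`. -/
def Dec (g : Perm (ℕ → Bool)) (s : Bool) (g₀ g₁ : Perm (ℕ → Bool)) : Prop :=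
  ∀ w, g (cns false w) = cns s (g₀ w) ∧ g (cns true w) = cns (!s) (g₁ w)

lemma exists_eq_cns (w : ℕ → Bool) : ∃ x v, w = cns x v :=
  ⟨w 0, fun n => w (n + 1), by funext n; cases n <;> rfl⟩

lemma cns_right_injective (x : Bool) : Function.Injective (cns x) := by
  intro v w h
  funext n
  exact congrFun h (n + 1)

lemma Dec.eq {g h : Perm (ℕ → Bool)} {s : Bool} {g₀ g₁ : Perm (ℕ → Bool)}
    (hg : Dec g s g₀ g₁) (hh : Dec h s g₀ g₁) : g = h := by
  ext1 w
  obtain ⟨x, v, rfl⟩ := exists_eq_cns w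
  cases x
  · rw [(hg v).1, (hh v).1]
  · rw [(hg v).2, (hh v).2]

lemma Dec.unique {g : Perm (ℕ → Bool)} {s : Bool} {g₀ g₁ h₀ h₁ : Perm (ℕ → Bool)}
    (hg : Dec g s g₀ g₁) (hh : Dec g s h₀ h₁) : g₀ = h₀ ∧ g₁ = h₁ := by
  constructor
  · ext1 w
    exact cns_right_injective s ((hg w).1.symm.trans (hh w).1)
  · ext1 w
    exact cns_right_injective (!s) ((hg w).2.symm.trans (hh w).2)

lemma Dec.one : Dec 1 false 1 1 := fun _ => ⟨rfl, rfl⟩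

lemma Dec.mul {g h g₀ g₁ h₀ h₁ : Perm (ℕ → Bool)} {s : Bool}
    (hg : Dec g s g₀ g₁) (hh : Dec h false h₀ h₁) : Dec (g * h) s (g₀ * h₀) (g₁ * h₁) := by
  intro w
  simp only [Equiv.Perm.mul_apply]
  exact ⟨by rw [(hh w).1, (hg _).1], by rw [(hh w).2]; exact (hg _).2⟩

lemma Dec.mul_swap {g h g₀ g₁ h₀ h₁ : Perm (ℕ → Bool)} {s : Bool}
    (hg : Dec g s g₀ g₁) (hh : Dec h true h₀ h₁) : Dec (g * h) (!s) (g₁ * h₀) (g₀ * h₁) := by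
  intro w
  simp only [Equiv.Perm.mul_apply]
  refine ⟨by rw [(hh w).1, (hg _).2], ?_⟩
  rw [(hh w).2, Bool.not_true, (hg _).1, Bool.not_not]

namespace IsGenerators

variable {a b c d : Perm (ℕ → Bool)}

lemma dec_a (H : IsGenerators a b c d) : Dec a true 1 1 := fun w => ⟨H.a0 w, H.a1 w⟩

lemma dec_b (H : IsGenerators a b c d) : Dec b false a c := fun w => ⟨H.b0 w, H.b1 w⟩

lemma dec_c (H : IsGenerators a b c d) : Dec c false a d := fun w => ⟨H.c0 w, H.c1 w⟩

lemma dec_d (H : IsGenerators a b c d) : Dec d false 1 b := fun w => ⟨H.d0 w, H.d1 w⟩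

lemma aa (H : IsGenerators a b c d) : a * a = 1 :=
  (H.dec_a.mul_swap H.dec_a).eq Dec.one

lemma a_apply_a (H : IsGenerators a b c d) (w : ℕ → Bool) : a (a w) = w := by
  rw [← Equiv.Perm.mul_apply, H.aa, Equiv.Perm.one_apply]

lemma squares_apply (H : IsGenerators a b c d) (n : ℕ) :
    ∀ w, b (b w) n = w n ∧ c (c w) n = w n ∧ d (d w) n = w n := by
  induction n with
  | zero =>
    intro w
    obtain ⟨x, v, rfl⟩ := exists_eq_cns w
    cases x <;> simp [H.b0, H.b1, H.c0, H.c1, H.d0, H.d1, cns]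
  | succ n ih =>
    intro w
    obtain ⟨x, v, rfl⟩ := exists_eq_cns w
    cases x <;> simp [H.b0, H.b1, H.c0, H.c1, H.d0, H.d1, cns, H.a_apply_a, ih]

lemma bb (H : IsGenerators a b c d) : b * b = 1 := by
  ext w n : 2
  exact (H.squares_apply n w).1

lemma cc (H : IsGenerators a b c d) : c * c = 1 := by
  ext w n : 2
  exact (H.squares_apply n w).2.1

lemma dd (H : IsGenerators a b c d) : d * d = 1 := by
  ext w n : 2
  exact (H.squares_apply n w).2.2

lemma products_apply (H : IsGenerators a b c d) (n : ℕ) :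
    ∀ w, b (c w) n = d w n ∧ c (d w) n = b w n ∧ d (b w) n = c w n := by
  induction n with
  | zero =>
    intro w
    obtain ⟨x, v, rfl⟩ := exists_eq_cns w
    cases x <;> simp [H.b0, H.b1, H.c0, H.c1, H.d0, H.d1, cns]
  | succ n ih =>
    intro w
    obtain ⟨x, v, rfl⟩ := exists_eq_cns w
    cases x <;> simp [H.b0, H.b1, H.c0, H.c1, H.d0, H.d1, cns, H.a_apply_a, ih]

lemma bc (H : IsGenerators a b c d) : b * c = d := by
  ext w n : 2
  exact (H.products_apply n w).1

lemma cd (H : IsGenerators a b c d) : c * d = b := by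
  ext w n : 2
  exact (H.products_apply n w).2.1

lemma db (H : IsGenerators a b c d) : d * b = c := by
  ext w n : 2
  exact (H.products_apply n w).2.2

lemma cb (H : IsGenerators a b c d) : c * b = d := by
  rw [← H.cd, ← mul_assoc, H.cc, one_mul]

lemma dc (H : IsGenerators a b c d) : d * c = b := by
  rw [← H.db, ← mul_assoc, H.dd, one_mul]

lemma bd (H : IsGenerators a b c d) : b * d = c := by
  rw [← H.bc, ← mul_assoc, H.bb, one_mul]

lemma a_ne_one (H : IsGenerators a b c d) : a ≠ 1 := by
  rintro rfl
  have := congrFun (H.a0 fun _ => false) 0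
  simp [cns] at this

lemma c_ne_d (H : IsGenerators a b c d) : c ≠ d := by
  intro h
  have h1 := H.dec_c
  rw [h] at h1
  exact H.a_ne_one (h1.unique H.dec_d).1

/-- Conjugation by `a` exchanges the two sections. -/
lemma dec_conj (H : IsGenerators a b c d) {g g₀ g₁ : Perm (ℕ → Bool)}
    (hg : Dec g false g₀ g₁) : Dec (a * g * a) false g₁ g₀ := by
  simpa using (H.dec_a.mul hg).mul_swap H.dec_a

end IsGenerators

/-! ### Upper bound -/

/-- `Word a b c d g m`: the element `g` is the product of a word of weight `m`, where the letters
`a`, `b`, `c`, `d` have weights `274`, `312`, `201`, `111`. These are close to a multiple of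
`1 - η ^ 3`, `η ^ 3`, `1 - η ^ 2`, `1 - η`, with `η` the real root of `X ^ 3 + X ^ 2 + X - 2`. -/
inductive Word (a b c d : Perm (ℕ → Bool)) : Perm (ℕ → Bool) → ℕ → Prop
  | one : Word a b c d 1 0
  | a_mul {g m} : Word a b c d g m → Word a b c d (a * g) (274 + m)
  | b_mul {g m} : Word a b c d g m → Word a b c d (b * g) (312 + m)
  | c_mul {g m} : Word a b c d g m → Word a b c d (c * g) (201 + m)
  | d_mul {g m} : Word a b c d g m → Word a b c d (d * g) (111 + m)

/-- The elements of the Klein four-group `{1, b, c, d}` with their weights. -/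
inductive Block (b c d : Perm (ℕ → Bool)) : Perm (ℕ → Bool) → ℕ → Prop
  | one : Block b c d 1 0
  | b : Block b c d b 312
  | c : Block b c d c 201
  | d : Block b c d d 111

/-- Products of elements of `{1, b, c, d}` separated by letters `a`, with their weights. -/
inductive AltWord (a b c d : Perm (ℕ → Bool)) : Perm (ℕ → Bool) → ℕ → Prop
  | block {v k} : Block b c d v k → AltWord a b c d v k
  | cons {v k g m} : Block b c d v k → AltWord a b c d g m →
      AltWord a b c d (v * a * g) (k + 274 + m)

section Weights

variable {a b c d : Perm (ℕ → Bool)}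

lemma IsGenerators.block_mul (H : IsGenerators a b c d) {u v : Perm (ℕ → Bool)} {j k : ℕ}
    (hu : Block b c d u j) (hv : Block b c d v k) : ∃ m ≤ j + k, Block b c d (u * v) m := by
  cases hu with
  | one => exact ⟨k, by simp, by simpa using hv⟩
  | b =>
    cases hv with
    | one => exact ⟨_, le_rfl, Block.b⟩
    | b => exact ⟨0, by simp, H.bb ▸ Block.one⟩
    | c => exact ⟨111, by simp, H.bc ▸ Block.d⟩
    | d => exact ⟨201, by simp, H.bd ▸ Block.c⟩
  | c =>
    cases hv with
    | one => exact ⟨_, le_rfl, Block.c⟩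
    | b => exact ⟨111, by simp, H.cb ▸ Block.d⟩
    | c => exact ⟨0, by simp, H.cc ▸ Block.one⟩
    | d => exact ⟨312, by simp, H.cd ▸ Block.b⟩
  | d =>
    cases hv with
    | one => exact ⟨_, le_rfl, Block.d⟩
    | b => exact ⟨201, by simp, H.db ▸ Block.c⟩
    | c => exact ⟨312, by simp, H.dc ▸ Block.b⟩
    | d => exact ⟨0, by simp, H.dd ▸ Block.one⟩

lemma IsGenerators.altWord_block_mul (H : IsGenerators a b c d) {u g : Perm (ℕ → Bool)} {j m : ℕ}
    (hu : Block b c d u j) (hg : AltWord a b c d g m) :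
    ∃ m' ≤ j + m, AltWord a b c d (u * g) m' := by
  cases hg with
  | block hv =>
    obtain ⟨m', hm', h⟩ := H.block_mul hu hv
    exact ⟨m', hm', .block h⟩
  | cons hv hg =>
    obtain ⟨m', hm', h⟩ := H.block_mul hu hv
    refine ⟨_, ?_, by simpa only [mul_assoc] using AltWord.cons h hg⟩
    omega

lemma IsGenerators.exists_altWord (H : IsGenerators a b c d) {g : Perm (ℕ → Bool)} {m : ℕ}
    (hg : Word a b c d g m) : ∃ m' ≤ m, AltWord a b c d g m' := by
  induction hg with
  | one => exact ⟨0, le_rfl, .block .one⟩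
  | a_mul _ ih =>
    obtain ⟨m', hm', h⟩ := ih
    exact ⟨0 + 274 + m', by omega, by simpa only [one_mul] using AltWord.cons Block.one h⟩
  | b_mul _ ih =>
    obtain ⟨m', hm', h⟩ := ih
    obtain ⟨m'', hm'', hw⟩ := H.altWord_block_mul .b h
    exact ⟨m'', by omega, hw⟩
  | c_mul _ ih =>
    obtain ⟨m', hm', h⟩ := ih
    obtain ⟨m'', hm'', hw⟩ := H.altWord_block_mul .c h
    exact ⟨m'', by omega, hw⟩
  | d_mul _ ih =>
    obtain ⟨m', hm', h⟩ := ih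
    obtain ⟨m'', hm'', hw⟩ := H.altWord_block_mul .d h
    exact ⟨m'', by omega, hw⟩

/-- Multiplying by a block changes the sections by a controlled amount. -/
lemma IsGenerators.dec_block_mul (H : IsGenerators a b c d) {v g₀ g₁ : Perm (ℕ → Bool)}
    {k m₀ m₁ : ℕ} (hv : Block b c d v k) (h₀ : Word a b c d g₀ m₀) (h₁ : Word a b c d g₁ m₁) :
    ∃ v₀ v₁ n₀ n₁, Dec v false v₀ v₁ ∧ Word a b c d (v₀ * g₀) n₀ ∧ Word a b c d (v₁ * g₁) n₁ ∧
      586 * (n₀ + n₁) ≤ 586 * (m₀ + m₁) + 475 * (k + 274) := by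
  cases hv with
  | one => exact ⟨1, 1, m₀, m₁, Dec.one, by simpa using h₀, by simpa using h₁, by omega⟩
  | b => exact ⟨a, c, _, _, H.dec_b, h₀.a_mul, h₁.c_mul, by omega⟩
  | c => exact ⟨a, d, _, _, H.dec_c, h₀.a_mul, h₁.d_mul, by omega⟩
  | d => exact ⟨1, b, m₀, _, H.dec_d, by simpa using h₀, h₁.b_mul, by omega⟩

lemma IsGenerators.dec_altWord (H : IsGenerators a b c d) {g : Perm (ℕ → Bool)} {m : ℕ}
    (hg : AltWord a b c d g m) :
    ∃ s g₀ g₁ m₀ m₁, Dec g s g₀ g₁ ∧ Word a b c d g₀ m₀ ∧ Word a b c d g₁ m₁ ∧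
      586 * (m₀ + m₁) ≤ 475 * (m + 274) := by
  induction hg with
  | block hv =>
    obtain ⟨v₀, v₁, n₀, n₁, hd, h₀, h₁, hle⟩ := H.dec_block_mul hv .one .one
    exact ⟨false, v₀, v₁, n₀, n₁, hd, by simpa using h₀, by simpa using h₁, by linarith⟩
  | @cons v k g m hv _ ih =>
    obtain ⟨s, g₀, g₁, m₀, m₁, hg, h₀, h₁, hle⟩ := ih
    cases s with
    | false =>
      obtain ⟨v₀, v₁, n₁, n₀, hd, h₁', h₀', hle'⟩ := H.dec_block_mul hv h₁ h₀
      refine ⟨true, v₁ * g₀, v₀ * g₁, n₀, n₁, ?_, h₀', h₁', by linarith⟩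
      simpa using (hd.mul_swap H.dec_a).mul hg
    | true =>
      obtain ⟨v₀, v₁, n₀, n₁, hd, h₀', h₁', hle'⟩ := H.dec_block_mul hv h₀ h₁
      refine ⟨false, v₀ * g₀, v₁ * g₁, n₀, n₁, ?_, h₀', h₁', by linarith⟩
      simpa using (hd.mul_swap H.dec_a).mul_swap hg

/-- The ball of radius `n` for the weighted word metric. -/
def weightedBall (a b c d : Perm (ℕ → Bool)) (n : ℕ) : Set (Perm (ℕ → Bool)) :=
  {g | ∃ m ≤ n, Word a b c d g m}

/-- The ball of radius `n` with respect to a set `S`. -/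
def ball (S : Set (Perm (ℕ → Bool))) (n : ℕ) : Set (Perm (ℕ → Bool)) :=
  {g | ∃ l : List (Perm (ℕ → Bool)), l.length ≤ n ∧ (∀ x ∈ l, x ∈ S) ∧ l.prod = g}

lemma growthFn_eq (S : Set (Perm (ℕ → Bool))) (n : ℕ) : growthFn S n = (ball S n).ncard := rfl

lemma ball_finite {S : Set (Perm (ℕ → Bool))} (hS : S.Finite) (n : ℕ) : (ball S n).Finite := by
  have := hS.to_subtype
  refine ((List.finite_length_le S n).image fun l => (l.map Subtype.val).prod).subset ?_
  rintro g ⟨l, hl, hmem, rfl⟩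
  lift l to List S using hmem
  exact ⟨l, by simpa using hl, rfl⟩

lemma generators_finite (a b c d : Perm (ℕ → Bool)) :
    ({a, b, c, d} : Set (Perm (ℕ → Bool))).Finite := Set.toFinite _

lemma ball_mono (S : Set (Perm (ℕ → Bool))) : Monotone (ball S) := by
  rintro m n h g ⟨l, hl, hmem, rfl⟩
  exact ⟨l, hl.trans h, hmem, rfl⟩

lemma mul_mem_ball {S : Set (Perm (ℕ → Bool))} {x g : Perm (ℕ → Bool)} {n : ℕ} (hx : x ∈ S)
    (hg : g ∈ ball S n) : x * g ∈ ball S (n + 1) := by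
  obtain ⟨l, hl, hmem, rfl⟩ := hg
  exact ⟨x :: l, by simpa using hl, by simpa [hx] using hmem, by simp⟩

lemma one_mem_ball (S : Set (Perm (ℕ → Bool))) (n : ℕ) : 1 ∈ ball S n := ⟨[], by simp, by simp, rfl⟩

lemma Word.mem_ball {g : Perm (ℕ → Bool)} {m : ℕ} (hg : Word a b c d g m) :
    g ∈ ball {a, b, c, d} m := by
  induction hg with
  | one => exact one_mem_ball _ _
  | a_mul _ ih => exact ball_mono _ (by omega) (mul_mem_ball (by simp) ih)
  | b_mul _ ih => exact ball_mono _ (by omega) (mul_mem_ball (by simp) ih)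
  | c_mul _ ih => exact ball_mono _ (by omega) (mul_mem_ball (by simp) ih)
  | d_mul _ ih => exact ball_mono _ (by omega) (mul_mem_ball (by simp) ih)

lemma weightedBall_finite (n : ℕ) : (weightedBall a b c d n).Finite := by
  refine (ball_finite (generators_finite a b c d) n).subset ?_
  rintro g ⟨m, hm, hg⟩
  exact ball_mono _ hm hg.mem_ball

lemma ball_subset_weightedBall (n : ℕ) :
    ball {a, b, c, d} n ⊆ weightedBall a b c d (312 * n) := by
  rintro g ⟨l, hl, hmem, rfl⟩
  suffices ∃ m ≤ 312 * l.length, Word a b c d l.prod m by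
    obtain ⟨m, hm, h⟩ := this
    exact ⟨m, by omega, h⟩
  clear hl
  induction l with
  | nil => exact ⟨0, by simp, .one⟩
  | cons x l ih =>
    obtain ⟨m, hm, h⟩ := ih fun y hy => hmem y (List.mem_cons_of_mem _ hy)
    have hx := hmem x List.mem_cons_self
    simp only [Set.mem_insert_iff, Set.mem_singleton_iff] at hx
    rw [List.prod_cons, List.length_cons]
    rcases hx with rfl | rfl | rfl | rfl
    · exact ⟨_, by omega, h.a_mul⟩
    · exact ⟨_, by omega, h.b_mul⟩
    · exact ⟨_, by omega, h.c_mul⟩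
    · exact ⟨_, by omega, h.d_mul⟩

lemma weightedBall_zero : (weightedBall a b c d 0).ncard = 1 := by
  rw [Set.ncard_eq_one]
  refine ⟨1, Set.eq_singleton_iff_unique_mem.2 ⟨⟨0, le_rfl, .one⟩, ?_⟩⟩
  rintro g ⟨m, hm, hg⟩
  cases hg with
  | one => rfl
  | _ => omega

/-- The contraction property of sections gives a recursive bound for the size of balls. -/
lemma IsGenerators.ncard_weightedBall_le (H : IsGenerators a b c d) (n : ℕ) :
    (weightedBall a b c d n).ncard ≤
      2 * ∑ i ∈ Finset.range (475 * (n + 274) / 586 + 1),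
        (weightedBall a b c d i).ncard *
          (weightedBall a b c d (475 * (n + 274) / 586 - i)).ncard := by
  classical
  set N := 475 * (n + 274) / 586 with hN
  let F : ℕ → Finset (Perm (ℕ → Bool)) := fun m => (weightedBall_finite (a := a) (b := b)
    (c := c) (d := d) m).toFinset
  have hF : ∀ m, (weightedBall a b c d m).ncard = (F m).card := fun m =>
    Set.ncard_eq_toFinset_card _ _
  have key : ∀ g ∈ F n, ∃ p : Bool × Perm (ℕ → Bool) × Perm (ℕ → Bool),
      Dec g p.1 p.2.1 p.2.2 ∧
      p ∈ (Finset.univ : Finset Bool) ×ˢ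
        (Finset.range (N + 1)).biUnion fun i => F i ×ˢ F (N - i) := by
    intro g hg
    obtain ⟨m, hm, hg⟩ : g ∈ weightedBall a b c d n := by simpa [F] using hg
    obtain ⟨m', hm', hg⟩ := H.exists_altWord hg
    obtain ⟨s, g₀, g₁, m₀, m₁, hd, h₀, h₁, hle⟩ := H.dec_altWord hg
    refine ⟨(s, g₀, g₁), hd, ?_⟩
    have : m₀ + m₁ ≤ N := by rw [hN, Nat.le_div_iff_mul_le (by norm_num)]; omega
    simp only [Finset.mem_product, Finset.mem_univ, true_and, Finset.mem_biUnion,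
      Finset.mem_range, F, Set.Finite.mem_toFinset]
    exact ⟨m₀, by omega, ⟨m₀, le_rfl, h₀⟩, ⟨m₁, by omega, h₁⟩⟩
  choose! f hf hfm using key
  have hcard := Finset.card_le_card_of_injOn f hfm (by
    intro g hg h hh hgh
    have h1 := hf g hg
    rw [hgh] at h1
    exact h1.eq (hf h hh))
  simp only [hF]
  refine hcard.trans ?_
  rw [Finset.card_product, Finset.card_univ, Fintype.card_bool]
  refine Nat.mul_le_mul_left 2 (Finset.card_biUnion_le.trans (le_of_eq ?_))
  exact Finset.sum_congr rfl fun i _ => Finset.card_product _ _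

end Weights

set_option exponentiation.threshold 500 in
lemma two_mul_rpow_lt_one : 2 * (475 / 1172 : ℝ) ^ (0.7675 : ℝ) < 1 := by
  have h : ((475 / 1172 : ℝ) ^ (0.7675 : ℝ)) ^ 400 < (1 / 2) ^ 400 := by
    rw [← Real.rpow_natCast, ← Real.rpow_mul (by norm_num)]
    rw [show (0.7675 : ℝ) * (400 : ℕ) = (307 : ℕ) by norm_num, Real.rpow_natCast]
    norm_num
  have := lt_of_pow_lt_pow_left₀ 400 (by norm_num) h
  linarith

lemma rpow_add_rpow_le {p x y : ℝ} (hp₀ : 0 ≤ p) (hp₁ : p ≤ 1) (hx : 0 ≤ x) (hy : 0 ≤ y) :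
    x ^ p + y ^ p ≤ 2 * ((x + y) / 2) ^ p := by
  have h := (Real.concaveOn_rpow hp₀ hp₁).2 (Set.mem_Ici.2 hx) (Set.mem_Ici.2 hy)
    (by norm_num : (0 : ℝ) ≤ 1 / 2) (by norm_num : (0 : ℝ) ≤ 1 / 2) (by norm_num)
  simp only [smul_eq_mul] at h
  rw [show (x + y) / 2 = 1 / 2 * x + 1 / 2 * y by ring]
  linarith

lemma eventually_mul_rpow_le {δ₀ δ₁ : ℝ} (h₀ : 0 < δ₀) (h : δ₀ < δ₁) (r p : ℝ) (hr : 0 ≤ r) :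
    ∀ᶠ n : ℕ in atTop, δ₀ * ((n : ℝ) + r) ^ p ≤ δ₁ * (n : ℝ) ^ p := by
  have h1 : Tendsto (fun n : ℕ => (1 + r / (n : ℝ)) ^ p) atTop (nhds 1) := by
    have : Tendsto (fun n : ℕ => 1 + r / (n : ℝ)) atTop (nhds (1 + 0)) :=
      tendsto_const_nhds.add (tendsto_const_div_atTop_nhds_zero_nat r)
    simpa using this.rpow_const (p := p) (by simp)
  filter_upwards [h1.eventually_lt_const ((one_lt_div h₀).2 h), eventually_gt_atTop 0] with n hn hpos
  have hn' : (0 : ℝ) < n := by exact_mod_cast hpos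
  have e : (n : ℝ) + r = (1 + r / n) * n := by field_simp
  rw [e, Real.mul_rpow (by positivity) hn'.le, ← mul_assoc]
  gcongr
  rw [lt_div_iff₀ h₀] at hn
  linarith

lemma eventually_two_mul_le_exp {ε p : ℝ} (hε : 0 < ε) (hp : 0 < p) :
    ∀ᶠ n : ℕ in atTop, 2 * (n : ℝ) ≤ Real.exp (ε * (n : ℝ) ^ p) := by
  have h1 := ((isLittleO_log_rpow_atTop hp).comp_tendsto
    tendsto_natCast_atTop_atTop).bound (half_pos hε)
  have h2 : Tendsto (fun n : ℕ => (n : ℝ) ^ p) atTop atTop :=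
    (tendsto_rpow_atTop hp).comp tendsto_natCast_atTop_atTop
  filter_upwards [h1, h2.eventually_ge_atTop (Real.log 2 / (ε / 2)), eventually_gt_atTop 0]
    with n hn hn2 hpos
  have hn' : (0 : ℝ) < n := by exact_mod_cast hpos
  rw [div_le_iff₀ (half_pos hε)] at hn2
  simp only [Function.comp_apply, Real.norm_eq_abs] at hn
  rw [abs_of_nonneg (Real.rpow_nonneg hn'.le p)] at hn
  rw [← Real.log_le_iff_le_exp (by positivity), Real.log_mul two_ne_zero hn'.ne']
  linarith [le_abs_self (Real.log (n : ℝ))]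

/-- The recursive inequality satisfied by the sizes of balls forces subexponential growth. -/
lemma exists_le_exp_of_recursion {f : ℕ → ℕ} (hf₀ : f 0 = 1)
    (hf : ∀ n, f n ≤ 2 * ∑ i ∈ Finset.range (475 * (n + 274) / 586 + 1),
      f i * f (475 * (n + 274) / 586 - i)) :
    ∃ K : ℝ, 1 ≤ K ∧ ∀ n : ℕ, (f n : ℝ) ≤ Real.exp (K * (n : ℝ) ^ (0.7675 : ℝ)) := by
  have hδ := two_mul_rpow_lt_one
  set p : ℝ := 0.7675 with hp
  have hp₀ : 0 < p := by norm_num [hp]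
  have hp₁ : p ≤ 1 := by norm_num [hp]
  set δ₀ : ℝ := 2 * (475 / 1172 : ℝ) ^ p with hδ₀
  have hδ₀pos : 0 < δ₀ := by positivity
  obtain ⟨δ₁, hδ₁, hδ₁'⟩ := exists_between hδ
  obtain ⟨N₀, hN₀⟩ := eventually_atTop.1 ((eventually_mul_rpow_le hδ₀pos hδ₁ 274 p
    (by norm_num)).and ((eventually_two_mul_le_exp (sub_pos.2 hδ₁') hp₀).and
      (eventually_gt_atTop 1200)))
  refine ⟨1 + ∑ m ∈ Finset.range N₀, (f m : ℝ), by
    have : 0 ≤ ∑ m ∈ Finset.range N₀, (f m : ℝ) := by positivity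
    linarith, ?_⟩
  set K : ℝ := 1 + ∑ m ∈ Finset.range N₀, (f m : ℝ) with hK
  have hK1 : 1 ≤ K := by
    have : 0 ≤ ∑ m ∈ Finset.range N₀, (f m : ℝ) := by positivity
    linarith
  intro n
  induction n using Nat.strong_induction_on with
  | _ n ih =>
  rcases Nat.eq_zero_or_pos n with rfl | hpos
  · simp [hf₀, Real.zero_rpow hp₀.ne']
  rcases lt_or_ge n N₀ with hlt | hge
  · have h1 : (f n : ℝ) ≤ K := by
      have := Finset.single_le_sum (f := fun m => (f m : ℝ)) (fun m _ => by positivity)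
        (Finset.mem_range.2 hlt)
      linarith
    have h2 : (1 : ℝ) ≤ (n : ℝ) ^ p := Real.one_le_rpow (by exact_mod_cast hpos) hp₀.le
    have h3 : K ≤ K * (n : ℝ) ^ p := le_mul_of_one_le_right (by linarith) h2
    linarith [Real.add_one_le_exp (K * (n : ℝ) ^ p)]
  · obtain ⟨h1, h2, h3⟩ := hN₀ n hge
    set N := 475 * (n + 274) / 586 with hN
    have hNn : N < n := by omega
    have hNle : (N : ℝ) / 2 ≤ 475 / 1172 * ((n : ℝ) + 274) := by
      have : N * 586 ≤ 475 * (n + 274) := Nat.div_mul_le_self _ _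
      have : (N : ℝ) * 586 ≤ 475 * ((n : ℝ) + 274) := by exact_mod_cast this
      linarith
    have hterm : ∀ i ∈ Finset.range (N + 1),
        (f i : ℝ) * f (N - i) ≤ Real.exp (K * (δ₁ * (n : ℝ) ^ p)) := by
      intro i hi
      have hi' : i ≤ N := Nat.lt_succ_iff.1 (Finset.mem_range.1 hi)
      calc (f i : ℝ) * f (N - i)
          ≤ Real.exp (K * (i : ℝ) ^ p) * Real.exp (K * ((N - i : ℕ) : ℝ) ^ p) := by
            gcongr
            · exact ih i (by omega)
            · exact ih (N - i) (by omega)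
        _ = Real.exp (K * ((i : ℝ) ^ p + ((N - i : ℕ) : ℝ) ^ p)) := by
            rw [← Real.exp_add]; ring_nf
        _ ≤ Real.exp (K * (δ₁ * (n : ℝ) ^ p)) := by
            gcongr
            refine (rpow_add_rpow_le hp₀.le hp₁ (Nat.cast_nonneg _) (Nat.cast_nonneg _)).trans ?_
            rw [← Nat.cast_add, Nat.add_sub_cancel' hi']
            calc 2 * ((N : ℝ) / 2) ^ p
                ≤ 2 * (475 / 1172 * ((n : ℝ) + 274)) ^ p := by gcongr
              _ = δ₀ * ((n : ℝ) + 274) ^ p := by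
                rw [Real.mul_rpow (by norm_num) (by positivity), hδ₀, mul_assoc]
              _ ≤ _ := h1
    have hsum := Finset.sum_le_card_nsmul _ _ _ hterm
    rw [Finset.card_range, nsmul_eq_mul] at hsum
    have hfn : (f n : ℝ) ≤ 2 * ∑ i ∈ Finset.range (N + 1), (f i : ℝ) * f (N - i) := by
      exact_mod_cast hf n
    have hn1 : ((N + 1 : ℕ) : ℝ) ≤ n := by exact_mod_cast hNn
    calc (f n : ℝ) ≤ 2 * (((N + 1 : ℕ) : ℝ) * Real.exp (K * (δ₁ * (n : ℝ) ^ p))) := by linarith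
      _ ≤ 2 * ((n : ℝ) * Real.exp (K * (δ₁ * (n : ℝ) ^ p))) := by gcongr
      _ = 2 * (n : ℝ) * Real.exp (K * (δ₁ * (n : ℝ) ^ p)) := by ring
      _ ≤ Real.exp ((1 - δ₁) * (n : ℝ) ^ p) * Real.exp (K * (δ₁ * (n : ℝ) ^ p)) := by gcongr
      _ ≤ Real.exp (K * (n : ℝ) ^ p) := by
        rw [← Real.exp_add]
        gcongr
        have : (1 - δ₁) * (n : ℝ) ^ p ≤ K * ((1 - δ₁) * (n : ℝ) ^ p) :=
          le_mul_of_one_le_left (mul_nonneg (sub_pos.2 hδ₁').le (by positivity)) hK1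
        linarith

variable {a b c d : Perm (ℕ → Bool)}

theorem IsGenerators.exists_growthFn_le (H : IsGenerators a b c d) :
    ∃ C : ℕ, ∀ n : ℕ,
      (growthFn {a, b, c, d} n : ℝ) ≤ Real.exp (((C * n : ℕ) : ℝ) ^ (0.7675 : ℝ)) := by
  obtain ⟨K, hK, h⟩ := exists_le_exp_of_recursion (weightedBall_zero (a := a) (b := b) (c := c)
    (d := d)) H.ncard_weightedBall_le
  obtain ⟨L, hL⟩ := exists_nat_ge (K ^ ((0.7675 : ℝ)⁻¹))
  refine ⟨L * 312, fun n => ?_⟩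
  have h1 : growthFn {a, b, c, d} n ≤ (weightedBall a b c d (312 * n)).ncard :=
    Set.ncard_le_ncard (ball_subset_weightedBall n) (weightedBall_finite _)
  have h2 : (growthFn {a, b, c, d} n : ℝ) ≤ (weightedBall a b c d (312 * n)).ncard := by
    exact_mod_cast h1
  refine (h2.trans (h _)).trans (Real.exp_le_exp.2 ?_)
  rw [mul_assoc, Nat.cast_mul L, Real.mul_rpow (by positivity) (by positivity)]
  gcongr
  calc K = (K ^ ((0.7675 : ℝ)⁻¹)) ^ (0.7675 : ℝ) := by
        rw [← Real.rpow_mul (by linarith), inv_mul_cancel₀ (by norm_num), Real.rpow_one]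
    _ ≤ _ := Real.rpow_le_rpow (by positivity) hL (by norm_num)

/-! ### Lower bound -/

/-- Products of `n` factors from `{a * x, a * y}`. -/
def prods (a x y : Perm (ℕ → Bool)) : ℕ → Set (Perm (ℕ → Bool))
  | 0 => {1}
  | n + 1 => (· * (a * x)) '' prods a x y n ∪ (· * (a * y)) '' prods a x y n

section Prods

variable {x y : Perm (ℕ → Bool)}

lemma prods_finite (a x y : Perm (ℕ → Bool)) (n : ℕ) : (prods a x y n).Finite := by
  induction n with
  | zero => exact Set.finite_singleton _
  | succ n ih => exact (ih.image _).union (ih.image _)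

lemma mul_left_mem_prods {g : Perm (ℕ → Bool)} {n : ℕ} (hg : g ∈ prods a x y n) :
    g * (a * x) ∈ prods a x y (n + 1) := Or.inl ⟨g, hg, rfl⟩

lemma mul_right_mem_prods {g : Perm (ℕ → Bool)} {n : ℕ} (hg : g ∈ prods a x y n) :
    g * (a * y) ∈ prods a x y (n + 1) := Or.inr ⟨g, hg, rfl⟩

lemma mul_mem_prods {g h : Perm (ℕ → Bool)} {m n : ℕ} (hg : g ∈ prods a x y m)
    (hh : h ∈ prods a x y n) : g * h ∈ prods a x y (m + n) := by
  induction n generalizing h with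
  | zero =>
    obtain rfl : h = 1 := hh
    simpa using hg
  | succ n ih =>
    rw [← add_assoc]
    obtain ⟨h, hh, rfl⟩ | ⟨h, hh, rfl⟩ := hh
    · simpa only [mul_assoc] using mul_left_mem_prods (ih hh)
    · simpa only [mul_assoc] using mul_right_mem_prods (ih hh)

lemma prods_subset_ball (hx : x ∈ ({a, b, c, d} : Set (Perm (ℕ → Bool))))
    (hy : y ∈ ({a, b, c, d} : Set (Perm (ℕ → Bool)))) (n : ℕ) :
    prods a x y n ⊆ ball {a, b, c, d} (2 * n) := by
  have hmul : ∀ {g u : Perm (ℕ → Bool)} {k : ℕ}, g ∈ ball {a, b, c, d} k →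
      u ∈ ({a, b, c, d} : Set (Perm (ℕ → Bool))) → g * (a * u) ∈ ball {a, b, c, d} (k + 2) := by
    rintro _ u k ⟨l, hl, hmem, rfl⟩ hu
    refine ⟨l ++ [a, u], by simpa using hl, ?_, by simp⟩
    intro z hz
    rw [List.mem_append] at hz
    rcases hz with hz | hz
    · exact hmem z hz
    · simp only [List.mem_cons, List.not_mem_nil, or_false] at hz
      rcases hz with rfl | rfl
      · simp
      · exact hu
  induction n with
  | zero =>
    rintro _ rfl
    exact one_mem_ball _ _
  | succ n ih =>
    rintro _ (⟨g, hg, rfl⟩ | ⟨g, hg, rfl⟩)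
    · exact hmul (ih hg) hx
    · exact hmul (ih hg) hy

/-- A pair of words in `a`, `c`, `d` can be lifted to a word in `a`, `b`, `c` with no loss of
length. -/
lemma IsGenerators.exists_dec_prods (H : IsGenerators a b c d) (n : ℕ) :
    ∀ g ∈ prods a c d n, ∀ h ∈ prods a c d n, ∃ X ∈ prods a b c (2 * n),
      Dec X false (a * g * a) h := by
  induction n with
  | zero =>
    rintro _ rfl _ rfl
    exact ⟨1, rfl, by simpa [H.aa] using Dec.one⟩
  | succ n ih =>
    have hstep : ∀ {X g h u v s t : Perm (ℕ → Bool)}, Dec X false (a * g * a) h →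
        Dec u false a s → Dec v false a t →
        Dec (X * (a * u) * (a * v)) false (a * (g * (a * s)) * a) (h * (a * t)) := by
      intro X g h u v s t hX hu hv
      simpa only [mul_assoc] using hX.mul ((H.dec_conj hu).mul hv)
    rintro _ (⟨g, hg, rfl⟩ | ⟨g, hg, rfl⟩) _ (⟨h, hh, rfl⟩ | ⟨h, hh, rfl⟩) <;>
      obtain ⟨X, hX, hd⟩ := ih g hg h hh
    · exact ⟨_, mul_left_mem_prods (mul_left_mem_prods hX), hstep hd H.dec_b H.dec_b⟩
    · exact ⟨_, mul_right_mem_prods (mul_left_mem_prods hX), hstep hd H.dec_b H.dec_c⟩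
    · exact ⟨_, mul_left_mem_prods (mul_right_mem_prods hX), hstep hd H.dec_c H.dec_b⟩
    · exact ⟨_, mul_right_mem_prods (mul_right_mem_prods hX), hstep hd H.dec_c H.dec_c⟩

/-- The elements of the dihedral group generated by two involutions. -/
def dihedral (x y : Perm (ℕ → Bool)) : Set (Perm (ℕ → Bool)) :=
  Subgroup.zpowers (x * y) ∪ (· * x) '' (Subgroup.zpowers (x * y) : Set (Perm (ℕ → Bool)))

lemma dihedral_finite {n : ℕ} (hn : 0 < n) (h : (x * y) ^ n = 1) : (dihedral x y).Finite := by
  have : (Subgroup.zpowers (x * y) : Set (Perm (ℕ → Bool))).Finite :=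
    finite_zpowers.2 (isOfFinOrder_iff_pow_eq_one.2 ⟨n, hn, h⟩)
  exact this.union (this.image _)

lemma one_mem_dihedral : 1 ∈ dihedral x y := Or.inl (one_mem _)

lemma mul_left_mem_dihedral (hx : x * x = 1) {g : Perm (ℕ → Bool)} (hg : g ∈ dihedral x y) :
    g * x ∈ dihedral x y := by
  obtain hg | ⟨g, hg, rfl⟩ := hg
  · exact Or.inr ⟨g, hg, rfl⟩
  · left
    simpa [mul_assoc, hx] using hg

lemma mul_right_mem_dihedral (hy : y * y = 1) {g : Perm (ℕ → Bool)} (hg : g ∈ dihedral x y) :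
    g * y ∈ dihedral x y := by
  obtain hg | ⟨g, hg, rfl⟩ := hg
  · refine Or.inr ⟨g * (x * y)⁻¹, mul_mem hg (inv_mem (Subgroup.mem_zpowers _)), ?_⟩
    simp [inv_eq_of_mul_eq_one_left hy, mul_assoc]
  · left
    simpa only [mul_assoc, SetLike.mem_coe] using mul_mem hg (Subgroup.mem_zpowers (x * y))

lemma IsGenerators.ad_pow (H : IsGenerators a b c d) : (a * d) ^ 4 = 1 := by
  have h : Dec (a * d * a * d) false b b := by
    simpa using (H.dec_conj H.dec_d).mul H.dec_d
  have h2 := h.mul h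
  rw [H.bb] at h2
  rw [← h2.eq Dec.one]
  simp only [pow_succ, pow_zero, one_mul, mul_assoc]

lemma IsGenerators.ac_pow (H : IsGenerators a b c d) : (a * c) ^ 8 = 1 := by
  have h : Dec (a * c * a * c) false (d * a) (a * d) := (H.dec_conj H.dec_c).mul H.dec_c
  have h4 := ((h.mul h).mul h).mul h
  have e : a * d * (a * d) * (a * d) * (a * d) = 1 := by
    simpa only [pow_succ, pow_zero, one_mul] using H.ad_pow
  have e' : d * a * (d * a) * (d * a) * (d * a) = 1 := by
    have : (a * d)⁻¹ = d * a := by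
      rw [mul_inv_rev, inv_eq_of_mul_eq_one_left H.aa, inv_eq_of_mul_eq_one_left H.dd]
    rw [← this]
    have h4 : (a * d)⁻¹ ^ 4 = 1 := by rw [inv_pow, H.ad_pow, inv_one]
    simpa only [pow_succ, pow_zero, one_mul] using h4
  rw [e, e'] at h4
  rw [← h4.eq Dec.one]
  simp only [pow_succ, pow_zero, one_mul, mul_assoc]

variable {p : Perm (ℕ → Bool)}

/-- A word can be lifted to a word of twice its length with prescribed section at `1`, the other
section remaining in a dihedral group. -/
lemma IsGenerators.exists_dec_one (H : IsGenerators a b c d) (hp : Dec p false a y)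
    (hy : y * y = 1) (n : ℕ) : ∀ g ∈ prods a b y n, ∃ X ∈ prods a p d (2 * n),
      ∃ j ∈ dihedral a y, Dec X false j g := by
  induction n with
  | zero =>
    rintro _ rfl
    exact ⟨1, rfl, 1, one_mem_dihedral, Dec.one⟩
  | succ n ih =>
    rintro _ (⟨g, hg, rfl⟩ | ⟨g, hg, rfl⟩) <;> obtain ⟨X, hX, j, hj, hd⟩ := ih g hg
    · refine ⟨_, mul_right_mem_prods (mul_left_mem_prods hX), j * y,
        mul_right_mem_dihedral hy hj, ?_⟩
      simpa [mul_assoc] using hd.mul ((H.dec_conj hp).mul H.dec_d)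
    · refine ⟨_, mul_left_mem_prods (mul_left_mem_prods hX), j * y * a,
        mul_left_mem_dihedral H.aa (mul_right_mem_dihedral hy hj), ?_⟩
      simpa [mul_assoc] using hd.mul ((H.dec_conj hp).mul hp)

lemma IsGenerators.exists_dec_zero (H : IsGenerators a b c d) (hp : Dec p false a y)
    (hy : y * y = 1) (n : ℕ) : ∀ g ∈ prods a b y n, ∃ X ∈ prods a p d (2 * n),
      ∃ j ∈ dihedral a y, Dec X false (a * g * a) j := by
  induction n with
  | zero =>
    rintro _ rfl
    exact ⟨1, rfl, 1, one_mem_dihedral, by simpa [H.aa] using Dec.one⟩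
  | succ n ih =>
    rintro _ (⟨g, hg, rfl⟩ | ⟨g, hg, rfl⟩) <;> obtain ⟨X, hX, j, hj, hd⟩ := ih g hg
    · refine ⟨_, mul_left_mem_prods (mul_right_mem_prods hX), j * y,
        mul_right_mem_dihedral hy hj, ?_⟩
      simpa [mul_assoc] using hd.mul ((H.dec_conj H.dec_d).mul hp)
    · refine ⟨_, mul_left_mem_prods (mul_left_mem_prods hX), j * a * y,
        mul_right_mem_dihedral hy (mul_left_mem_dihedral H.aa hj), ?_⟩
      simpa [mul_assoc] using hd.mul ((H.dec_conj hp).mul hp)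

lemma IsGenerators.sq_ncard_prods_le (H : IsGenerators a b c d) (n : ℕ) :
    (prods a c d n).ncard ^ 2 ≤ (prods a b c (2 * n)).ncard := by
  choose! F hF hd using H.exists_dec_prods n
  rw [sq, ← Set.ncard_prod]
  refine Set.ncard_le_ncard_of_injOn (fun q => F q.1 q.2) (fun q hq => hF _ hq.1 _ hq.2) ?_
    (prods_finite _ _ _ _)
  rintro ⟨g, h⟩ hq ⟨g', h'⟩ hq' he
  have h1 := hd g hq.1 h hq.2
  rw [show F g h = F g' h' from he] at h1
  obtain ⟨e₀, e₁⟩ := h1.unique (hd g' hq'.1 h' hq'.2)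
  simp_all

lemma IsGenerators.ncard_prods_le (H : IsGenerators a b c d) (hp : Dec p false a y)
    (hy : y * y = 1) (n : ℕ) : (prods a b y n).ncard ≤ (prods a p d (2 * n)).ncard := by
  choose! F hF J hJ hd using H.exists_dec_one hp hy n
  refine Set.ncard_le_ncard_of_injOn F hF ?_ (prods_finite _ _ _ _)
  intro g hg g' hg' he
  have h0 := hd g hg
  rw [he] at h0
  ext1 w
  exact cns_right_injective true ((h0 w).2.symm.trans (hd g' hg' w).2)

lemma IsGenerators.sq_ncard_prods_le_mul (H : IsGenerators a b c d) (hp : Dec p false a y)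
    (hy : y * y = 1) (hfin : (dihedral a y).Finite) (n : ℕ) :
    (prods a b y n).ncard ^ 2 ≤ (prods a p d (4 * n)).ncard * (dihedral a y).ncard ^ 2 := by
  choose! F hF J hJ hd using H.exists_dec_one hp hy n
  choose! F' hF' J' hJ' hd' using H.exists_dec_zero hp hy n
  rw [sq, sq, ← Set.ncard_prod, ← Set.ncard_prod, ← Set.ncard_prod]
  refine Set.ncard_le_ncard_of_injOn (fun q => (F q.1 * F' q.2, J q.1, J' q.2)) ?_ ?_
    ((prods_finite _ _ _ _).prod (hfin.prod hfin))
  · rintro ⟨g, h⟩ ⟨hg, hh⟩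
    refine ⟨?_, hJ g hg, hJ' h hh⟩
    rw [show 4 * n = 2 * n + 2 * n by ring]
    exact mul_mem_prods (hF g hg) (hF' h hh)
  · rintro ⟨g, h⟩ hq ⟨g', h'⟩ hq' he
    simp only [Prod.mk.injEq] at he
    obtain ⟨he, hj, hj'⟩ := he
    have h1 := (hd g hq.1).mul (hd' h hq.2)
    rw [he, hj, hj'] at h1
    obtain ⟨e₀, e₁⟩ := h1.unique ((hd g' hq'.1).mul (hd' h' hq'.2))
    simp_all

lemma IsGenerators.ncard_prods_one (H : IsGenerators a b c d) : (prods a c d 1).ncard = 2 := by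
  have : prods a c d 1 = {a * c, a * d} := by
    ext g
    simp [prods, or_comm]
  rw [this, Set.ncard_pair]
  simpa using H.c_ne_d

lemma IsGenerators.two_pow_le_ncard_prods (H : IsGenerators a b c d) (k : ℕ) :
    2 ^ 2 ^ k ≤ (prods a c d (8 ^ k)).ncard := by
  induction k with
  | zero => simp [H.ncard_prods_one]
  | succ k ih =>
    calc 2 ^ 2 ^ (k + 1) = (2 ^ 2 ^ k) ^ 2 := by rw [← pow_mul, pow_succ]
      _ ≤ (prods a c d (8 ^ k)).ncard ^ 2 := Nat.pow_le_pow_left ih 2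
      _ ≤ (prods a b c (2 * 8 ^ k)).ncard := H.sq_ncard_prods_le _
      _ ≤ (prods a b d (2 * (2 * 8 ^ k))).ncard := H.ncard_prods_le H.dec_b H.cc _
      _ ≤ (prods a c d (2 * (2 * (2 * 8 ^ k)))).ncard := H.ncard_prods_le H.dec_c H.dd _
      _ = _ := by rw [pow_succ]; congr 2; ring

lemma IsGenerators.exists_pow_eight_le (H : IsGenerators a b c d) :
    ∃ M > 0, ∀ n, (prods a c d n).ncard ^ 8 ≤ (prods a c d (32 * n)).ncard * M := by
  have h1 : (dihedral a c).Finite := dihedral_finite (by norm_num) H.ac_pow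
  have h2 : (dihedral a d).Finite := dihedral_finite (by norm_num) H.ad_pow
  have p1 : 0 < (dihedral a c).ncard := (Set.ncard_pos h1).2 ⟨1, one_mem_dihedral⟩
  have p2 : 0 < (dihedral a d).ncard := (Set.ncard_pos h2).2 ⟨1, one_mem_dihedral⟩
  refine ⟨(dihedral a d).ncard ^ 2 * (dihedral a c).ncard ^ 4, by positivity, fun n => ?_⟩
  calc (prods a c d n).ncard ^ 8 = (((prods a c d n).ncard ^ 2) ^ 2) ^ 2 := by ring
    _ ≤ ((prods a b c (2 * n)).ncard ^ 2) ^ 2 := by gcongr; exact H.sq_ncard_prods_le n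
    _ ≤ ((prods a b d (4 * (2 * n))).ncard * (dihedral a c).ncard ^ 2) ^ 2 := by
      gcongr
      exact H.sq_ncard_prods_le_mul H.dec_b H.cc h1 _
    _ = (prods a b d (4 * (2 * n))).ncard ^ 2 * (dihedral a c).ncard ^ 4 := by ring
    _ ≤ (prods a c d (4 * (4 * (2 * n)))).ncard * (dihedral a d).ncard ^ 2 *
        (dihedral a c).ncard ^ 4 := by
      gcongr
      exact H.sq_ncard_prods_le_mul H.dec_c H.dd h2 _
    _ = _ := by
      rw [mul_assoc]
      congr 3
      ring

lemma IsGenerators.exists_pow_le_ncard_prods (H : IsGenerators a b c d) :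
    ∃ n, ∀ k, 3 ^ 8 ^ k ≤ (prods a c d (32 ^ k * n)).ncard := by
  obtain ⟨M, hM, h⟩ := H.exists_pow_eight_le
  refine ⟨8 ^ (3 * M), fun k => (Nat.le_mul_of_pos_left _ hM).trans (?_ : M * 3 ^ 8 ^ k ≤ _)⟩
  induction k with
  | zero =>
    calc M * 3 ^ 8 ^ 0 = 3 * M := by ring
      _ ≤ 2 ^ (3 * M) := Nat.lt_two_pow_self.le
      _ ≤ 2 ^ 2 ^ (3 * M) := Nat.pow_le_pow_right two_pos Nat.lt_two_pow_self.le
      _ ≤ _ := by simpa using H.two_pow_le_ncard_prods (3 * M)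
  | succ k ih =>
    refine Nat.le_of_mul_le_mul_right ?_ hM
    calc M * 3 ^ 8 ^ (k + 1) * M = M ^ 2 * (3 ^ 8 ^ k) ^ 8 := by rw [← pow_mul, pow_succ]; ring
      _ ≤ M ^ 8 * (3 ^ 8 ^ k) ^ 8 := by gcongr; norm_num
      _ = (M * 3 ^ 8 ^ k) ^ 8 := by ring
      _ ≤ (prods a c d (32 ^ k * 8 ^ (3 * M))).ncard ^ 8 := Nat.pow_le_pow_left ih 8
      _ ≤ (prods a c d (32 * (32 ^ k * 8 ^ (3 * M)))).ncard * M := h _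
      _ = _ := by
        congr 3
        ring

lemma growthFn_mono (a b c d : Perm (ℕ → Bool)) : Monotone (growthFn {a, b, c, d}) :=
  fun _ n h => Set.ncard_le_ncard (ball_mono _ h) (ball_finite (generators_finite a b c d) n)

theorem IsGenerators.exists_le_growthFn (H : IsGenerators a b c d) :
    ∃ C : ℕ, ∀ n : ℕ, 1 ≤ n →
      Real.exp ((n : ℝ) ^ (0.6 : ℝ)) ≤ (growthFn {a, b, c, d} (C * n) : ℝ) := by
  obtain ⟨n₀, h⟩ := H.exists_pow_le_ncard_prods
  refine ⟨64 * n₀, fun n hn => ?_⟩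
  set k := Nat.log 32 n
  have hk : 32 ^ k ≤ n := Nat.pow_log_le_self 32 (by omega)
  have hk' : n < 32 ^ (k + 1) := Nat.lt_pow_succ_log_self (by norm_num) n
  have hle : 3 ^ 8 ^ (k + 1) ≤ growthFn {a, b, c, d} (64 * n₀ * n) := by
    refine (h (k + 1)).trans ((Set.ncard_le_ncard (prods_subset_ball (b := b) (by simp) (by simp) _)
      (ball_finite (generators_finite a b c d) _)).trans (growthFn_mono a b c d ?_))
    calc 2 * (32 ^ (k + 1) * n₀) = 64 * n₀ * 32 ^ k := by ring
      _ ≤ 64 * n₀ * n := by gcongr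
  have hpow : (n : ℝ) ^ (0.6 : ℝ) ≤ ((8 ^ (k + 1) : ℕ) : ℝ) := by
    calc (n : ℝ) ^ (0.6 : ℝ) ≤ ((32 ^ (k + 1) : ℕ) : ℝ) ^ (0.6 : ℝ) := by
          gcongr
      _ = ((8 ^ (k + 1) : ℕ) : ℝ) := by
        rw [show (32 : ℕ) ^ (k + 1) = (2 ^ (k + 1)) ^ 5 by rw [← pow_mul, mul_comm, pow_mul]; norm_num,
          show (8 : ℕ) ^ (k + 1) = (2 ^ (k + 1)) ^ 3 by rw [← pow_mul, mul_comm, pow_mul]; norm_num,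
          Nat.cast_pow, Nat.cast_pow _ 3, ← Real.rpow_natCast, ← Real.rpow_mul (by positivity),
          ← Real.rpow_natCast _ 3]
        norm_num
  calc Real.exp ((n : ℝ) ^ (0.6 : ℝ)) ≤ Real.exp ((8 ^ (k + 1) : ℕ) : ℝ) := by gcongr
    _ = Real.exp 1 ^ 8 ^ (k + 1) := by rw [Real.exp_one_pow]
    _ ≤ 3 ^ 8 ^ (k + 1) := by gcongr; exact Real.exp_one_lt_three.le
    _ ≤ _ := by exact_mod_cast hle

end Prods

end Grigorchuk

open Grigorchuk

/-- The Grigorchuk group has intermediate growth, with the bounds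
`exp(n^0.5157) ≼ γ(n) ≼ exp(n^0.7675)`; in particular its growth function grows faster
than every polynomial and slower than every exponential function `b^n`, `b > 1`. -/
theorem grigorchuk_intermediate_growth
    (a b c d : Equiv.Perm (ℕ → Bool))
    (ha0 : ∀ w, a (cns false w) = cns true w)
    (ha1 : ∀ w, a (cns true w) = cns false w)
    (hb0 : ∀ w, b (cns false w) = cns false (a w))
    (hb1 : ∀ w, b (cns true w) = cns true (c w))
    (hc0 : ∀ w, c (cns false w) = cns false (a w))
    (hc1 : ∀ w, c (cns true w) = cns true (d w))
    (hd0 : ∀ w, d (cns false w) = cns false w)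
    (hd1 : ∀ w, d (cns true w) = cns true (b w)) :
    (∃ C : ℕ, 1 ≤ C ∧ ∀ᶠ n : ℕ in atTop,
        Real.exp ((n : ℝ) ^ (0.5157 : ℝ)) ≤ (growthFn {a, b, c, d} (C * n) : ℝ) ∧
        (growthFn {a, b, c, d} n : ℝ) ≤ Real.exp (((C * n : ℕ) : ℝ) ^ (0.7675 : ℝ))) ∧
    (∀ k : ℕ, ∀ᶠ n : ℕ in atTop, (n : ℝ) ^ k ≤ (growthFn {a, b, c, d} n : ℝ)) ∧
    (∀ β : ℝ, 1 < β → ∀ᶠ n : ℕ in atTop, (growthFn {a, b, c, d} n : ℝ) ≤ β ^ n) := by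
  have H : IsGenerators a b c d := ⟨ha0, ha1, hb0, hb1, hc0, hc1, hd0, hd1⟩
  obtain ⟨L, hL⟩ := H.exists_le_growthFn
  obtain ⟨U, hU⟩ := H.exists_growthFn_le
  refine ⟨⟨L + U + 1, by omega, ?_⟩, fun k => ?_, fun β hβ => ?_⟩
  · filter_upwards [eventually_ge_atTop 1] with n hn
    have hn' : (1 : ℝ) ≤ n := by exact_mod_cast hn
    constructor
    · calc Real.exp ((n : ℝ) ^ (0.5157 : ℝ)) ≤ Real.exp ((n : ℝ) ^ (0.6 : ℝ)) :=
          Real.exp_le_exp.2 (Real.rpow_le_rpow_of_exponent_le hn' (by norm_num))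
        _ ≤ growthFn {a, b, c, d} (L * n) := hL n hn
        _ ≤ _ := by
          exact_mod_cast growthFn_mono a b c d (Nat.mul_le_mul_right n (by omega))
    · refine (hU n).trans (Real.exp_le_exp.2 (Real.rpow_le_rpow (by positivity) ?_ (by norm_num)))
      exact_mod_cast Nat.mul_le_mul_right n (by omega)
  · have hlog := ((isLittleO_log_rpow_atTop (r := 0.6) (by norm_num)).comp_tendsto
      tendsto_natCast_atTop_atTop).bound
      (by positivity : 0 < ((k + 1 : ℝ) * (2 * (L + 1)) ^ (0.6 : ℝ))⁻¹)
    filter_upwards [hlog, eventually_ge_atTop (L + 1)] with n hn hge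
    have hn1 : (1 : ℝ) ≤ n := by exact_mod_cast (by omega : 1 ≤ n)
    have hn0 : (0 : ℝ) < n := by linarith
    set m := n / (L + 1) with hm
    have hm1 : 1 ≤ m := (Nat.one_le_div_iff (by omega)).2 hge
    have hnm : n ≤ 2 * (L + 1) * m := by
      have h1 : n < (L + 1) * (m + 1) := Nat.lt_mul_div_succ n (by omega)
      nlinarith
    have hLm : L * m ≤ n := (Nat.mul_le_mul_right m (by omega)).trans (Nat.mul_div_le n (L + 1))
    simp only [Function.comp_apply, Real.norm_eq_abs] at hn
    rw [abs_of_nonneg (Real.log_nonneg hn1), abs_of_nonneg (by positivity), inv_mul_eq_div,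
      le_div_iff₀ (by positivity)] at hn
    have hpow : (n : ℝ) ^ (0.6 : ℝ) ≤ (2 * (L + 1)) ^ (0.6 : ℝ) * (m : ℝ) ^ (0.6 : ℝ) := by
      rw [← Real.mul_rpow (by positivity) (by positivity)]
      refine Real.rpow_le_rpow hn0.le ?_ (by norm_num)
      exact_mod_cast hnm
    have hkey : (k : ℝ) * Real.log n ≤ (m : ℝ) ^ (0.6 : ℝ) := by
      have hpos : (0 : ℝ) < (2 * (L + 1)) ^ (0.6 : ℝ) := by positivity
      refine le_of_mul_le_mul_left ?_ hpos
      nlinarith [mul_nonneg hpos.le (Real.log_nonneg hn1)]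
    calc (n : ℝ) ^ k = Real.exp (k * Real.log n) := by
          rw [mul_comm, Real.exp_mul, Real.exp_log hn0, Real.rpow_natCast]
      _ ≤ Real.exp ((m : ℝ) ^ (0.6 : ℝ)) := Real.exp_le_exp.2 hkey
      _ ≤ growthFn {a, b, c, d} (L * m) := hL m hm1
      _ ≤ _ := by exact_mod_cast growthFn_mono a b c d hLm
  · have hlim : Tendsto (fun n : ℕ => (U : ℝ) ^ (0.7675 : ℝ) * (n : ℝ) ^ (-0.2325 : ℝ)) atTop
        (nhds ((U : ℝ) ^ (0.7675 : ℝ) * 0)) :=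
      ((tendsto_rpow_neg_atTop (by norm_num)).comp tendsto_natCast_atTop_atTop).const_mul _
    rw [mul_zero] at hlim
    filter_upwards [hlim.eventually_lt_const (Real.log_pos hβ), eventually_ge_atTop 1] with n hn hn1
    have hn0 : (0 : ℝ) < n := by exact_mod_cast hn1
    refine (hU n).trans ?_
    rw [← Real.exp_log (by linarith : 0 < β), ← Real.exp_nat_mul]
    refine Real.exp_le_exp.2 ?_
    calc ((U * n : ℕ) : ℝ) ^ (0.7675 : ℝ)
        = n * ((U : ℝ) ^ (0.7675 : ℝ) * (n : ℝ) ^ (-0.2325 : ℝ)) := by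
          rw [Nat.cast_mul, Real.mul_rpow (by positivity) (by positivity),
            show (0.7675 : ℝ) = 1 + -0.2325 by norm_num, Real.rpow_add hn0, Real.rpow_one]
          ring
      _ ≤ n * Real.log β := by gcongr
end

section
/- Let F₃ be the free group on three generators a, c, d, and let σ : F₃ → F₃ be the endomorphism determined by σ(a) = aca, σ(c) = cd, σ(d) = c. Let π : F₃ → Sym({0,1}^ω) be the homomorphism sending the generators a, c, d to the corresponding generators a, c, d of the Grigorchuk group 𝐆. Then π is surjective onto 𝐆 and its kernel is the normal closure in F₃ of the set {σ^i(a²), σ^i((ad)⁴), σ^i((adacac)⁴) : i ≥ 0}; that is, 𝐆 admits the presentation 𝐆 = ⟨a, c, d | σ^i(a²), σ^i((ad)⁴), σ^i((adacac)⁴), i ≥ 0⟩. -/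
/-- The substitution `σ` on the free group on `a, c, d` (indexed `0, 1, 2`):
`σ(a) = aca`, `σ(c) = cd`, `σ(d) = c`. -/
def grigSigma : Monoid.End (FreeGroup (Fin 3)) :=
  FreeGroup.lift fun i =>
    if i = 0 then FreeGroup.of 0 * FreeGroup.of 1 * FreeGroup.of 0
    else if i = 1 then FreeGroup.of 1 * FreeGroup.of 2
    else FreeGroup.of 1


/-- The homomorphism from the free group on three generators sending them to `x`, `y`, `z`. -/
abbrev grigLift {G : Type*} [Group G] (x y z : G) : FreeGroup (Fin 3) →* G :=
  FreeGroup.lift fun i => if i = 0 then x else if i = 1 then y else z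

/-- The relators of the `L`-presentation. -/
def grigRels : Set (FreeGroup (Fin 3)) :=
  {x | ∃ i : ℕ,
    x = (grigSigma ^ i) (FreeGroup.of 0 * FreeGroup.of 0) ∨
    x = (grigSigma ^ i) ((FreeGroup.of 0 * FreeGroup.of 2) ^ 4) ∨
    x = (grigSigma ^ i) ((FreeGroup.of 0 * FreeGroup.of 2 * FreeGroup.of 0 *
      FreeGroup.of 1 * FreeGroup.of 0 * FreeGroup.of 1) ^ 4)}

@[simp] lemma grigSigma_of_zero : grigSigma (FreeGroup.of 0) =
    FreeGroup.of 0 * FreeGroup.of 1 * FreeGroup.of 0 :=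
  FreeGroup.lift_apply_of

@[simp] lemma grigSigma_of_one : grigSigma (FreeGroup.of 1) =
    FreeGroup.of 1 * FreeGroup.of 2 :=
  FreeGroup.lift_apply_of

@[simp] lemma grigSigma_of_two : grigSigma (FreeGroup.of 2) = FreeGroup.of 1 :=
  FreeGroup.lift_apply_of

lemma grigSigma_pow_succ (i : ℕ) (x : FreeGroup (Fin 3)) :
    (grigSigma ^ (i + 1)) x = grigSigma ((grigSigma ^ i) x) := by
  rw [pow_succ']; rfl

lemma grigSigma_mem_rels {x : FreeGroup (Fin 3)} (hx : x ∈ grigRels) :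
    grigSigma x ∈ grigRels := by
  obtain ⟨i, h⟩ := hx
  refine ⟨i + 1, ?_⟩
  simp only [grigSigma_pow_succ]
  rcases h with rfl | rfl | rfl <;> simp

/-- A homomorphism sending `a, c, d` to involutions, the last two of which commute. -/
structure InvolutiveHom {G : Type*} [Group G] (f : FreeGroup (Fin 3) →* G) : Prop where
  zero : f (FreeGroup.of 0) * f (FreeGroup.of 0) = 1
  one : f (FreeGroup.of 1) * f (FreeGroup.of 1) = 1
  two : f (FreeGroup.of 2) * f (FreeGroup.of 2) = 1
  comm : f (FreeGroup.of 2) * f (FreeGroup.of 1) = f (FreeGroup.of 1) * f (FreeGroup.of 2)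

lemma mul_mul_cancel_of_mul_self {G : Type*} [Group G] {x : G} (h : x * x = 1) (y : G) :
    x * (x * y) = y := by
  rw [← mul_assoc, h, one_mul]

lemma InvolutiveHom.comp_sigma {G : Type*} [Group G] {f : FreeGroup (Fin 3) →* G}
    (hf : InvolutiveHom f) : InvolutiveHom (f.comp grigSigma) := by
  obtain ⟨h0, h1, h2, h⟩ := hf
  have h0' := mul_mul_cancel_of_mul_self h0
  have h1' := mul_mul_cancel_of_mul_self h1
  have h' : ∀ y, f (FreeGroup.of 2) * (f (FreeGroup.of 1) * y) =
      f (FreeGroup.of 1) * (f (FreeGroup.of 2) * y) := fun y => by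
    rw [← mul_assoc, h, mul_assoc]
  have e0 : f.comp grigSigma (FreeGroup.of 0) =
      f (FreeGroup.of 0) * f (FreeGroup.of 1) * f (FreeGroup.of 0) := by
    rw [← map_mul, ← map_mul, ← grigSigma_of_zero]; rfl
  have e1 : f.comp grigSigma (FreeGroup.of 1) = f (FreeGroup.of 1) * f (FreeGroup.of 2) := by
    rw [← map_mul, ← grigSigma_of_one]; rfl
  have e2 : f.comp grigSigma (FreeGroup.of 2) = f (FreeGroup.of 1) := by
    rw [← grigSigma_of_two]; rfl
  constructor <;> simp only [e0, e1, e2, mul_assoc, mul_one, h0, h1, h2, h, h0', h1', h']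

lemma InvolutiveHom.map_sigma_pow {G : Type*} [Group G] {f : FreeGroup (Fin 3) →* G}
    (hf : InvolutiveHom f) (i : ℕ) :
    f ((grigSigma ^ i) (FreeGroup.of 0 * FreeGroup.of 0)) = 1 := by
  induction i generalizing f with
  | zero => simpa using hf.zero
  | succ i ih => rw [grigSigma_pow_succ]; exact ih hf.comp_sigma

lemma InvolutiveHom.map_rels {G : Type*} [Group G] {f : FreeGroup (Fin 3) →* G}
    (hf : InvolutiveHom f) (h4 : ∀ x, f x ^ 4 = 1) {r : FreeGroup (Fin 3)}
    (hr : r ∈ grigRels) : f r = 1 := by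
  obtain ⟨i, rfl | rfl | rfl⟩ := hr
  · exact hf.map_sigma_pow i
  · simp only [map_pow, h4]
  · simp only [map_pow, h4]

lemma grigRels_induction {P : FreeGroup (Fin 3) → Prop}
    (h1 : P (FreeGroup.of 0 * FreeGroup.of 0)) (h2 : P ((FreeGroup.of 0 * FreeGroup.of 2) ^ 4))
    (h3 : P ((FreeGroup.of 0 * FreeGroup.of 2 * FreeGroup.of 0 *
      FreeGroup.of 1 * FreeGroup.of 0 * FreeGroup.of 1) ^ 4))
    (hs : ∀ r ∈ grigRels, P r → P (grigSigma r)) {r : FreeGroup (Fin 3)} (hr : r ∈ grigRels) :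
    P r := by
  obtain ⟨i, hi⟩ := hr
  induction i generalizing r with
  | zero => rcases hi with rfl | rfl | rfl <;> assumption
  | succ i ih =>
    simp only [grigSigma_pow_succ] at hi
    rcases hi with rfl | rfl | rfl
    · exact hs _ ⟨i, Or.inl rfl⟩ (ih (Or.inl rfl))
    · exact hs _ ⟨i, Or.inr (Or.inl rfl)⟩ (ih (Or.inr (Or.inl rfl)))
    · exact hs _ ⟨i, Or.inr (Or.inr rfl)⟩ (ih (Or.inr (Or.inr rfl)))

lemma grigLift_dihedral_pow_four {G : Type*} [Group G] {a d : G} (ha : a * a = 1)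
    (hd : d * d = 1) (had : d * (a * (d * a)) = a * (d * (a * d))) (x : FreeGroup (Fin 3)) :
    grigLift d a a x ^ 4 = 1 := by
  have ha' := mul_mul_cancel_of_mul_self ha
  have hd' := mul_mul_cancel_of_mul_self hd
  have had' : ∀ y, d * (a * (d * (a * y))) = a * (d * (a * (d * y))) := fun y => by
    simpa only [mul_assoc] using congrArg (· * y) had
  have hx : grigLift d a a x ∈ Subgroup.closure ({a, d} : Set G) := by
    refine (FreeGroup.range_lift_le (s := Subgroup.closure ({a, d} : Set G)) ?_) ⟨x, rfl⟩
    rintro _ ⟨i, rfl⟩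
    apply Subgroup.subset_closure
    fin_cases i <;> simp
  have key : ∀ y ∈ Subgroup.closure ({a, d} : Set G), y = 1 ∨ y = a ∨ y = d ∨
      y = a * d ∨ y = d * a ∨ y = a * (d * a) ∨ y = d * (a * d) ∨ y = a * (d * (a * d)) := by
    intro y hy
    have hA : ∀ y : G, (y = 1 ∨ y = a ∨ y = d ∨ y = a * d ∨ y = d * a ∨
        y = a * (d * a) ∨ y = d * (a * d) ∨ y = a * (d * (a * d))) →
        (a * y = 1 ∨ a * y = a ∨ a * y = d ∨ a * y = a * d ∨ a * y = d * a ∨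
        a * y = a * (d * a) ∨ a * y = d * (a * d) ∨ a * y = a * (d * (a * d))) := by
      rintro _ (rfl | rfl | rfl | rfl | rfl | rfl | rfl | rfl) <;>
        simp only [mul_one, ha, ha', true_or, or_true]
    have hD : ∀ y : G, (y = 1 ∨ y = a ∨ y = d ∨ y = a * d ∨ y = d * a ∨
        y = a * (d * a) ∨ y = d * (a * d) ∨ y = a * (d * (a * d))) →
        (d * y = 1 ∨ d * y = a ∨ d * y = d ∨ d * y = a * d ∨ d * y = d * a ∨
        d * y = a * (d * a) ∨ d * y = d * (a * d) ∨ d * y = a * (d * (a * d))) := by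
      rintro _ (rfl | rfl | rfl | rfl | rfl | rfl | rfl | rfl) <;>
        simp only [mul_one, hd, hd', had, had', true_or, or_true]
    induction hy using Subgroup.closure_induction_left with
    | one => exact Or.inl rfl
    | mul_left x hx y _ ih =>
      rcases hx with rfl | rfl
      · exact hA y ih
      · exact hD y ih
    | inv_mul_cancel x hx y _ ih =>
      rcases hx with rfl | rfl
      · rw [inv_eq_of_mul_eq_one_left ha]; exact hA y ih
      · rw [inv_eq_of_mul_eq_one_left hd]; exact hD y ih
  rcases key _ hx with h | h | h | h | h | h | h | h <;> rw [h] <;>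
    simp only [pow_succ, pow_zero, one_mul, mul_assoc, mul_one, ha, ha', hd, hd', had, had']

lemma grigLift_dihedral_rels {G : Type*} [Group G] {a d : G} (ha : a * a = 1)
    (hd : d * d = 1) (had : d * (a * (d * a)) = a * (d * (a * d))) {r : FreeGroup (Fin 3)}
    (hr : r ∈ grigRels) : grigLift d a a r = 1 := by
  refine InvolutiveHom.map_rels ⟨?_, ?_, ?_, ?_⟩ (grigLift_dihedral_pow_four ha hd had) hr <;>
    simp [ha, hd]

lemma alternating_of_mul_pow_four {G : Type*} [Group G] {a d : G} (ha : a * a = 1)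
    (hd : d * d = 1) (had : (a * d) ^ 4 = 1) : d * (a * (d * a)) = a * (d * (a * d)) := by
  have h : a * d * (a * d) * (a * d * (a * d)) = 1 := by
    simpa only [pow_succ, pow_zero, one_mul, mul_assoc] using had
  have h := eq_inv_of_mul_eq_one_left h
  simp only [mul_inv_rev, inv_eq_of_mul_eq_one_left ha, inv_eq_of_mul_eq_one_left hd,
    mul_assoc] at h
  exact h.symm

/-- The permutation of `Bool × G` exchanging the two copies of `G`. -/
def swapPerm (G : Type*) : Equiv.Perm (Bool × G) := Equiv.prodCongr Equiv.boolNot (Equiv.refl _)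

/-- The action of `G × G` on `Bool × G` by left multiplication. -/
def pairPerm {G : Type*} [Group G] : G × G →* Equiv.Perm (Bool × G) where
  toFun p := Equiv.prodShear (Equiv.refl Bool) fun e => Equiv.mulLeft (cond e p.2 p.1)
  map_one' := by ext ⟨e, g⟩ <;> cases e <;> simp
  map_mul' p q := by ext ⟨e, g⟩ <;> cases e <;> simp

@[simp] lemma swapPerm_apply {G : Type*} (e : Bool) (g : G) : swapPerm G (e, g) = (!e, g) := rfl

@[simp] lemma pairPerm_apply_false {G : Type*} [Group G] (p : G × G) (g : G) :
    pairPerm p (false, g) = (false, p.1 * g) := rfl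

@[simp] lemma pairPerm_apply_true {G : Type*} [Group G] (p : G × G) (g : G) :
    pairPerm p (true, g) = (true, p.2 * g) := rfl

lemma swapPerm_mul_pairPerm_mul_swapPerm {G : Type*} [Group G] (x y : G) :
    swapPerm G * pairPerm (x, y) * swapPerm G = pairPerm (y, x) := by
  ext ⟨e, g⟩ <;> cases e <;> simp

lemma swapPerm_mul_swapPerm (G : Type*) : swapPerm G * swapPerm G = 1 := by
  ext ⟨e, g⟩ <;> cases e <;> simp

/-- The wreath recursion on the free group, for elements `a`, `c`, `d` of any group. -/
def grigSections {G : Type*} [Group G] (a c d : G) :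
    FreeGroup (Fin 3) →* Equiv.Perm (Bool × G) :=
  grigLift (swapPerm G) (pairPerm (a, d)) (pairPerm (1, c * d))

lemma grigSections_sigma {G : Type*} [Group G] {a c d : G} (hd : d * d = 1) (hcd : d * c = c * d)
    (x : FreeGroup (Fin 3)) :
    grigSections a c d (grigSigma x) = pairPerm (grigLift d a a x, grigLift a c d x) := by
  have h : (grigSections a c d).comp grigSigma =
      pairPerm.comp ((grigLift d a a).prod (grigLift a c d)) := by
    ext1 i
    change grigSections a c d (grigSigma (FreeGroup.of i)) =
      pairPerm (grigLift d a a (FreeGroup.of i), grigLift a c d (FreeGroup.of i))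
    fin_cases i
    · simp [grigSections, swapPerm_mul_pairPerm_mul_swapPerm]
    · suffices pairPerm (a, d) * pairPerm (1, c * d) = pairPerm (a, c) by simpa [grigSections]
      rw [← map_mul, Prod.mk_mul_mk, mul_one, ← hcd, mul_mul_cancel_of_mul_self hd]
    · simp [grigSections]
  exact DFunLike.congr_fun h x

lemma pairPerm_sq {G : Type*} [Group G] {x y : G} (hx : x * x = 1) (hy : y * y = 1) :
    pairPerm (x, y) ^ 2 = 1 := by
  rw [pow_two, ← map_mul, Prod.mk_mul_mk, hx, hy]; exact map_one _

lemma grigSections_of_zero_mul_of_zero {G : Type*} [Group G] (a c d : G) :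
    grigSections a c d (FreeGroup.of 0 * FreeGroup.of 0) = 1 := by
  simp [grigSections, swapPerm_mul_swapPerm]

lemma grigSections_pow_four {G : Type*} [Group G] {a c d : G} (hc : c * c = 1) (hd : d * d = 1)
    (hcd : d * c = c * d) :
    grigSections a c d ((FreeGroup.of 0 * FreeGroup.of 2) ^ 4) = 1 := by
  have h : grigSections a c d ((FreeGroup.of 0 * FreeGroup.of 2) ^ 2) =
      pairPerm (c * d, c * d) := by
    ext ⟨e, g⟩ <;> cases e <;> simp [grigSections, pow_two]
  have hb : c * d * (c * d) = 1 := by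
    rw [mul_assoc, ← mul_assoc d, hcd, mul_assoc, hd, mul_one, hc]
  rw [show 4 = 2 * 2 from rfl, pow_mul, map_pow, h, pairPerm_sq hb hb]

lemma grigSections_long_pow_four {G : Type*} [Group G] {a c d : G} (ha : a * a = 1)
    (hc : c * c = 1) (hd : d * d = 1) (hcd : d * c = c * d) :
    grigSections a c d ((FreeGroup.of 0 * FreeGroup.of 2 * FreeGroup.of 0 *
      FreeGroup.of 1 * FreeGroup.of 0 * FreeGroup.of 1) ^ 4) = 1 := by
  have ha' := mul_mul_cancel_of_mul_self ha
  have hc' := mul_mul_cancel_of_mul_self hc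
  have hd' := mul_mul_cancel_of_mul_self hd
  have h : grigSections a c d ((FreeGroup.of 0 * FreeGroup.of 2 * FreeGroup.of 0 *
      FreeGroup.of 1 * FreeGroup.of 0 * FreeGroup.of 1) ^ 2) =
      pairPerm (c * d, d * a * (c * d) * a * d) := by
    ext ⟨e, g⟩ <;> cases e <;> simp [grigSections, pow_two, mul_assoc, ha', hd']
  have hb : c * d * (c * d) = 1 := by
    rw [mul_assoc, ← mul_assoc d, hcd, mul_assoc, hd, mul_one, hc]
  have hb' (x : G) : d * (c * x) = c * (d * x) := by rw [← mul_assoc, hcd, mul_assoc]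
  rw [show 4 = 2 * 2 from rfl, pow_mul, map_pow, h, pairPerm_sq hb]
  simp only [mul_assoc, ha', hd', hd, hb', hc']

lemma grigSections_rels {G : Type*} [Group G] {a c d : G} (ha : a * a = 1)
    (hc : c * c = 1) (hd : d * d = 1) (hcd : d * c = c * d) (had : (a * d) ^ 4 = 1)
    (hrel : ∀ r ∈ grigRels, grigLift a c d r = 1) {r : FreeGroup (Fin 3)} (hr : r ∈ grigRels) :
    grigSections a c d r = 1 := by
  refine grigRels_induction (P := fun r => grigSections a c d r = 1)
    (grigSections_of_zero_mul_of_zero a c d) (grigSections_pow_four hc hd hcd)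
    (grigSections_long_pow_four ha hc hd hcd) (fun r hr _ => ?_) hr
  rw [grigSections_sigma hd hcd, hrel r hr,
    grigLift_dihedral_rels ha hd (alternating_of_mul_pow_four ha hd had) hr]
  exact map_one _

/-- The finitely generated group given by the `L`-presentation. -/
abbrev GrigPres : Type := PresentedGroup grigRels

namespace GrigPres

/-- The generator `a`. -/
def A : GrigPres := PresentedGroup.of 0

/-- The generator `c`. -/
def C : GrigPres := PresentedGroup.of 1

/-- The generator `d`. -/
def D : GrigPres := PresentedGroup.of 2

/-- A homomorphism from the free group that kills the relators descends to `GrigPres`. -/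
def lift {G : Type*} [Group G] (f : FreeGroup (Fin 3) →* G) (h : ∀ r ∈ grigRels, f r = 1) :
    GrigPres →* G :=
  QuotientGroup.lift _ f fun _ hx =>
    Subgroup.normalClosure_le_normal (N := f.ker) (fun r hr => h r hr) hx

@[simp] lemma lift_A {G : Type*} [Group G] (f : FreeGroup (Fin 3) →* G)
    (h : ∀ r ∈ grigRels, f r = 1) : lift f h A = f (FreeGroup.of 0) :=
  rfl

@[simp] lemma lift_C {G : Type*} [Group G] (f : FreeGroup (Fin 3) →* G)
    (h : ∀ r ∈ grigRels, f r = 1) : lift f h C = f (FreeGroup.of 1) :=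
  rfl

@[simp] lemma lift_D {G : Type*} [Group G] (f : FreeGroup (Fin 3) →* G)
    (h : ∀ r ∈ grigRels, f r = 1) : lift f h D = f (FreeGroup.of 2) :=
  rfl

/-- The endomorphism of `GrigPres` induced by the substitution. -/
def sigma : GrigPres →* GrigPres :=
  lift ((PresentedGroup.mk grigRels).comp grigSigma)
    fun _ hr => PresentedGroup.one_of_mem (grigSigma_mem_rels hr)

lemma sigma_A : sigma A = A * C * A :=
  congrArg (PresentedGroup.mk grigRels) grigSigma_of_zero

lemma sigma_C : sigma C = C * D :=
  congrArg (PresentedGroup.mk grigRels) grigSigma_of_one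

lemma sigma_D : sigma D = C :=
  congrArg (PresentedGroup.mk grigRels) grigSigma_of_two

lemma A_mul_A : A * A = 1 :=
  PresentedGroup.one_of_mem (rels := grigRels) ⟨0, Or.inl rfl⟩

lemma A_D_pow_four : (A * D) ^ 4 = 1 :=
  PresentedGroup.one_of_mem (rels := grigRels) ⟨0, Or.inr (Or.inl rfl)⟩

lemma A_D_A_C_A_C_pow_four : (A * D * A * C * A * C) ^ 4 = 1 :=
  PresentedGroup.one_of_mem (rels := grigRels) ⟨0, Or.inr (Or.inr rfl)⟩

lemma A_mul_A_mul (x : GrigPres) : A * (A * x) = x := mul_mul_cancel_of_mul_self A_mul_A x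

lemma A_inv : A⁻¹ = A := inv_eq_of_mul_eq_one_left A_mul_A

lemma C_mul_C : C * C = 1 := by
  have h := congrArg sigma A_mul_A
  rw [map_mul, sigma_A, map_one] at h
  have h2 : A * C * A * (A * C * A) = A * (C * C) * A⁻¹ := by
    simp only [mul_assoc, A_mul_A_mul, A_inv]
  rwa [h2, conj_eq_one_iff] at h

lemma C_mul_C_mul (x : GrigPres) : C * (C * x) = x := mul_mul_cancel_of_mul_self C_mul_C x

lemma C_inv : C⁻¹ = C := inv_eq_of_mul_eq_one_left C_mul_C

lemma C_mul_D_mul_C_mul_D : C * D * (C * D) = 1 := by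
  simpa only [map_mul, map_one, sigma_C] using congrArg sigma C_mul_C

lemma D_mul_D : D * D = 1 := by
  have h := congrArg sigma C_mul_D_mul_C_mul_D
  rw [map_mul, map_mul, sigma_C, sigma_D, map_one] at h
  have h2 : C * D * C * (C * D * C) = C * (D * D) * C⁻¹ := by
    simp only [mul_assoc, C_mul_C_mul, C_inv]
  rwa [h2, conj_eq_one_iff] at h

lemma D_mul_D_mul (x : GrigPres) : D * (D * x) = x := mul_mul_cancel_of_mul_self D_mul_D x

lemma D_inv : D⁻¹ = D := inv_eq_of_mul_eq_one_left D_mul_D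

lemma D_mul_C : D * C = C * D := by
  have h := eq_inv_of_mul_eq_one_left C_mul_D_mul_C_mul_D
  rwa [mul_inv_rev, C_inv, D_inv, eq_comm] at h

lemma D_mul_C_mul (x : GrigPres) : D * (C * x) = C * (D * x) := by
  rw [← mul_assoc, D_mul_C, mul_assoc]

lemma D_A_D_A : D * (A * (D * A)) = A * (D * (A * D)) :=
  alternating_of_mul_pow_four A_mul_A D_mul_D A_D_pow_four

lemma D_A_D_A_mul (x : GrigPres) : D * (A * (D * (A * x))) = A * (D * (A * (D * x))) := by
  have := congrArg (· * x) D_A_D_A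
  simpa only [mul_assoc] using this

/-- `d` commutes with its conjugate by `acaca`. -/
lemma D_conj_comm :
    D * (A * (C * (A * (C * (A * (D * (A * (C * (A * (C * A)))))))))) =
      A * (C * (A * (C * (A * (D * (A * (C * (A * (C * (A * D)))))))))) := by
  have h : (A * D * A * C * A * C) ^ 2 * (A * D * A * C * A * C) ^ 2 = 1 := by
    rw [← pow_add]; exact A_D_A_C_A_C_pow_four
  have h := eq_inv_of_mul_eq_one_left h
  simp only [pow_two, mul_inv_rev, A_inv, C_inv, D_inv, mul_assoc] at h
  have h := congrArg (fun t => A * (t * A)) h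
  simpa only [mul_assoc, A_mul_A_mul, C_mul_C_mul, A_mul_A, mul_one] using h

lemma D_conj_comm_mul (x : GrigPres) :
    D * (A * (C * (A * (C * (A * (D * (A * (C * (A * (C * (A * x))))))))))) =
      A * (C * (A * (C * (A * (D * (A * (C * (A * (C * (A * (D * x))))))))))) := by
  have := congrArg (· * x) D_conj_comm
  simpa only [mul_assoc] using this

@[elab_as_elim]
lemma induction_left {P : GrigPres → Prop} (one : P 1) (hA : ∀ g, P g → P (A * g))
    (hC : ∀ g, P g → P (C * g)) (hD : ∀ g, P g → P (D * g)) (g : GrigPres) : P g := by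
  have hg : g ∈ Subgroup.closure (Set.range (PresentedGroup.of (rels := grigRels))) := by
    rw [PresentedGroup.closure_range_of]; trivial
  induction hg using Subgroup.closure_induction_left with
  | one => exact one
  | mul_left x hx y _ ih =>
    obtain ⟨i, rfl⟩ := hx
    fin_cases i
    · exact hA y ih
    · exact hC y ih
    · exact hD y ih
  | inv_mul_cancel x hx y _ ih =>
    obtain ⟨i, rfl⟩ := hx
    fin_cases i
    · exact A_inv ▸ hA y ih
    · exact C_inv ▸ hC y ih
    · exact D_inv ▸ hD y ih


/-- The homomorphism recording the first sections of elements in the image of `sigma`. -/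
def tau : GrigPres →* GrigPres :=
  lift (grigLift D A A) fun _ => grigLift_dihedral_rels A_mul_A D_mul_D D_A_D_A

lemma tau_A : tau A = D := by simp [tau]

lemma tau_C : tau C = A := by simp [tau]

lemma tau_D : tau D = A := by simp [tau]

lemma mk_eq_grigLift : PresentedGroup.mk grigRels = grigLift A C D := by
  ext1 i
  fin_cases i <;> simp <;> rfl

/-- The wreath recursion on `GrigPres`. -/
def sections : GrigPres →* Equiv.Perm (Bool × GrigPres) :=
  lift (grigSections A C D) fun _ =>
    grigSections_rels A_mul_A C_mul_C D_mul_D D_mul_C A_D_pow_four fun r hr => by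
      rw [← mk_eq_grigLift]; exact PresentedGroup.one_of_mem hr

lemma sections_A : sections A = swapPerm GrigPres := by simp [sections, grigSections]

lemma sections_C : sections C = pairPerm (A, D) := by simp [sections, grigSections]

lemma sections_D : sections D = pairPerm (1, C * D) := by simp [sections, grigSections]

lemma sections_sigma (x : GrigPres) : sections (sigma x) = pairPerm (tau x, x) := by
  obtain ⟨x, rfl⟩ := PresentedGroup.mk_surjective _ x
  have h := grigSections_sigma (a := A) D_mul_D D_mul_C x
  rwa [← mk_eq_grigLift] at h

/-- The normal closure of `b = cd`, given by explicit generators. -/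
def normalB : Subgroup GrigPres :=
  Subgroup.closure {C * D, A * (C * (D * A)), D * (A * (C * (D * (A * D)))),
    A * (D * (A * (C * (D * (A * (D * A))))))}

lemma tau_eq_one_of_mem {x : GrigPres} (hx : x ∈ normalB) : tau x = 1 := by
  have h : normalB ≤ tau.ker := by
    refine (Subgroup.closure_le _).2 ?_
    rintro _ (rfl | rfl | rfl | rfl) <;>
      simp [tau_A, tau_C, tau_D, A_mul_A, A_mul_A_mul, D_mul_D, D_mul_D_mul]
  exact h hx

lemma conj_mem_closure {G : Type*} [Group G] {s : Set G} {t : G} (ht : t * t = 1)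
    (h : ∀ x ∈ s, t * x * t ∈ Subgroup.closure s) {x : G} (hx : x ∈ Subgroup.closure s) :
    t * x * t ∈ Subgroup.closure s := by
  have ht' : t⁻¹ = t := inv_eq_of_mul_eq_one_left ht
  have key : Subgroup.closure s ≤ (Subgroup.closure s).comap (MulAut.conj t).toMonoidHom := by
    refine (Subgroup.closure_le _).2 fun y hy => ?_
    simpa [ht'] using h y hy
  simpa [ht'] using key hx

lemma A_conj_mem {x : GrigPres} (hx : x ∈ normalB) : A * x * A ∈ normalB := by
  refine conj_mem_closure A_mul_A ?_ hx
  rintro _ (rfl | rfl | rfl | rfl) <;> apply Subgroup.subset_closure <;>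
    simp only [mul_assoc, A_mul_A, A_mul_A_mul, mul_one, Set.mem_insert_iff, true_or, or_true,
      Set.mem_singleton_iff]

lemma D_conj_mem {x : GrigPres} (hx : x ∈ normalB) : D * x * D ∈ normalB := by
  refine conj_mem_closure D_mul_D ?_ hx
  rintro _ (rfl | rfl | rfl | rfl) <;> apply Subgroup.subset_closure
  · simp only [D_mul_D, D_mul_C_mul, mul_one, Set.mem_insert_iff, true_or]
  · simp only [mul_assoc, Set.mem_insert_iff, true_or, or_true]
  · simp only [mul_assoc, D_mul_D, D_mul_D_mul, mul_one, Set.mem_insert_iff, true_or, or_true]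
  · have h : D * (A * (D * (A * (C * (D * (A * (D * A))))))) * D =
        A * (D * (A * (C * (D * (A * (D * A)))))) := by
      simp only [mul_assoc, ← D_A_D_A, D_A_D_A_mul, D_mul_C_mul, D_mul_D_mul]
    rw [h]
    simp only [Set.mem_insert_iff, Set.mem_singleton_iff, or_true]

lemma ADA_conj_sigma {x : GrigPres} (hx : x ∈ normalB) :
    A * (D * A) * sigma x * (A * (D * A)) = sigma x := by
  have key : normalB ≤ (Subgroup.centralizer {A * (D * A)}).comap sigma := by
    refine (Subgroup.closure_le _).2 ?_
    rintro _ (rfl | rfl | rfl | rfl) <;>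
      simp only [Subgroup.coe_comap, Set.mem_preimage, map_mul, sigma_A, sigma_C, sigma_D,
        SetLike.mem_coe, Subgroup.mem_centralizer_singleton_iff, mul_assoc, A_mul_A_mul,
        C_mul_C_mul, D_mul_C_mul]
    · simp only [D_mul_C, C_mul_C_mul, D_A_D_A]
    · simp only [D_A_D_A_mul, D_mul_C_mul]
    · have h := congrArg (fun t => A * (t * A)) D_conj_comm.symm
      simpa only [mul_assoc, A_mul_A, A_mul_A_mul, mul_one] using h
    · simp only [D_conj_comm_mul, D_mul_C_mul]

  have h := Subgroup.mem_centralizer_singleton_iff.1 (key hx)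
  rw [← h]
  simp only [mul_assoc, A_mul_A, A_mul_A_mul, D_mul_D_mul, mul_one]

lemma A_sigma_A_conj_mem (g : GrigPres) :
    ∀ y ∈ normalB.map sigma, A * sigma g * A * y * (A * sigma g * A)⁻¹ ∈ normalB.map sigma := by
  have hA : ∀ y ∈ normalB.map sigma, C * y * C ∈ normalB.map sigma := by
    rintro _ ⟨x, hx, rfl⟩
    exact ⟨D * x * D, D_conj_mem hx, by rw [map_mul, map_mul, sigma_D]⟩
  have hD : ∀ y ∈ normalB.map sigma, A * C * A * y * (A * C * A) ∈ normalB.map sigma := by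
    rintro _ ⟨x, hx, rfl⟩
    exact ⟨A * x * A, A_conj_mem hx, by rw [map_mul, map_mul, sigma_A]⟩
  have hB : ∀ y ∈ normalB.map sigma, A * (D * A) * y * (A * (D * A)) ∈ normalB.map sigma := by
    rintro _ ⟨x, hx, rfl⟩
    exact ⟨x, hx, (ADA_conj_sigma hx).symm⟩
  induction g using induction_left with
  | one => intro y hy; simpa [A_mul_A] using hy
  | hA g ih =>
    intro y hy
    convert hA _ (ih y hy) using 1
    simp only [map_mul, mul_inv_rev, sigma_A, A_inv, C_inv, mul_assoc, A_mul_A_mul]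
  | hC g ih =>
    intro y hy
    convert hD _ (hB _ (ih y hy)) using 1
    simp only [map_mul, mul_inv_rev, sigma_C, A_inv, C_inv, D_inv, mul_assoc, A_mul_A_mul]
  | hD g ih =>
    intro y hy
    convert hD _ (ih y hy) using 1
    simp only [map_mul, mul_inv_rev, sigma_D, A_inv, C_inv, mul_assoc, A_mul_A_mul]

lemma exists_eq_sigma_mul (g : GrigPres) : ∃ x, ∃ q ∈ normalB.map sigma,
    g = sigma x * (A * q * A) ∨ g = A * (sigma x * (A * q * A)) := by
  induction g using induction_left with
  | one => exact ⟨1, 1, one_mem _, Or.inl (by simp [A_mul_A])⟩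
  | hA g ih =>
    obtain ⟨x, q, hq, rfl | rfl⟩ := ih
    · exact ⟨x, q, hq, Or.inr rfl⟩
    · exact ⟨x, q, hq, Or.inl (A_mul_A_mul _)⟩
  | hC g ih =>
    obtain ⟨x, q, hq, rfl | rfl⟩ := ih
    · exact ⟨D * x, q, hq, Or.inl (by simp only [map_mul, sigma_D, mul_assoc])⟩
    · refine ⟨A * x, q, hq, Or.inr ?_⟩
      simp only [map_mul, sigma_A, mul_assoc, A_mul_A_mul]
  | hD g ih =>
    obtain ⟨x, q, hq, rfl | rfl⟩ := ih
    · refine ⟨D * C * x, q, hq, Or.inl ?_⟩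
      simp only [map_mul, sigma_C, sigma_D, mul_assoc, D_mul_C_mul, C_mul_C_mul]
    · refine ⟨x, A * sigma x⁻¹ * A * D * (A * sigma x⁻¹ * A)⁻¹ * q, mul_mem ?_ hq, Or.inr ?_⟩
      · refine A_sigma_A_conj_mem x⁻¹ D ⟨C * D, Subgroup.subset_closure (Or.inl rfl), ?_⟩
        rw [map_mul, sigma_C, sigma_D, mul_assoc, D_mul_C, C_mul_C_mul]
      · simp only [map_inv, mul_inv_rev, inv_inv, A_inv, mul_assoc, A_mul_A_mul,
          mul_inv_cancel_left]

theorem sections_injective : Function.Injective sections := by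
  refine (injective_iff_map_eq_one _).2 fun g hg => ?_
  have hpair (x y : GrigPres) : sections (sigma x * (A * sigma y * A)) =
      pairPerm (tau x * y, x * tau y) := by
    rw [map_mul, map_mul, map_mul, sections_A, sections_sigma, sections_sigma,
      swapPerm_mul_pairPerm_mul_swapPerm, ← map_mul, Prod.mk_mul_mk]
  obtain ⟨x, _, ⟨y, hy, rfl⟩, rfl | rfl⟩ := exists_eq_sigma_mul g
  · rw [hpair, tau_eq_one_of_mem hy, mul_one] at hg
    have hx : x = 1 := by simpa using DFunLike.congr_fun hg (true, 1)
    subst hx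
    have hy : y = 1 := by simpa using DFunLike.congr_fun hg (false, 1)
    subst hy
    simp [A_mul_A]
  · rw [map_mul, hpair, sections_A] at hg
    simpa using DFunLike.congr_fun hg (true, 1)

/-- The subset `{1, b, c, d}` of `GrigPres`, where `b = cd`. -/
def letters : Set GrigPres := {1, C, D, C * D}

lemma one_mem_letters : (1 : GrigPres) ∈ letters := Or.inl rfl

lemma C_mul_mem_letters {x : GrigPres} (hx : x ∈ letters) : C * x ∈ letters := by
  rcases hx with rfl | rfl | rfl | rfl <;> simp [letters, C_mul_C, C_mul_C_mul]

lemma D_mul_mem_letters {x : GrigPres} (hx : x ∈ letters) : D * x ∈ letters := by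
  rcases hx with rfl | rfl | rfl | rfl <;> simp [letters, D_mul_D, D_mul_C, D_mul_C_mul]

lemma mul_mem_letters {x y : GrigPres} (hx : x ∈ letters) (hy : y ∈ letters) :
    x * y ∈ letters := by
  rcases hx with rfl | rfl | rfl | rfl
  · rwa [one_mul]
  · exact C_mul_mem_letters hy
  · exact D_mul_mem_letters hy
  · rw [mul_assoc]; exact C_mul_mem_letters (D_mul_mem_letters hy)

/-- `AltWord n g` states that `g = a x₁ a x₂ ⋯ a xₙ` for some letters `x₁, …, xₙ`. -/
inductive AltWord : ℕ → GrigPres → Prop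
  | one : AltWord 0 1
  | cons {n : ℕ} {x g : GrigPres} : x ∈ letters → AltWord n g → AltWord (n + 1) (A * (x * g))

/-- `LenLE n g` states that `g` can be written with at most `n` occurrences of `a`. -/
def LenLE (n : ℕ) (g : GrigPres) : Prop :=
  ∃ m ≤ n, ∃ x ∈ letters, ∃ h, AltWord m h ∧ g = x * h

lemma LenLE.one : LenLE 0 1 := ⟨0, le_rfl, 1, one_mem_letters, 1, AltWord.one, (one_mul 1).symm⟩

lemma LenLE.mono {m n : ℕ} {g : GrigPres} (hg : LenLE m g) (hmn : m ≤ n) : LenLE n g := by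
  obtain ⟨k, hk, hg⟩ := hg
  exact ⟨k, hk.trans hmn, hg⟩

lemma LenLE.letter_mul {n : ℕ} {x g : GrigPres} (hx : x ∈ letters) (hg : LenLE n g) :
    LenLE n (x * g) := by
  obtain ⟨k, hk, y, hy, h, hh, rfl⟩ := hg
  exact ⟨k, hk, x * y, mul_mem_letters hx hy, h, hh, (mul_assoc x y h).symm⟩

lemma LenLE.A_mul {n : ℕ} {g : GrigPres} (hg : LenLE n g) : LenLE (n + 1) (A * g) := by
  obtain ⟨k, hk, y, hy, h, hh, rfl⟩ := hg
  exact ⟨k + 1, Nat.succ_le_succ hk, 1, one_mem_letters, _, AltWord.cons hy hh,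
    (one_mul _).symm⟩

lemma LenLE.mul_of_eq {n : ℕ} {u g : GrigPres} (hu : u = 1 ∨ u = A) (hg : LenLE n g) :
    LenLE (n + 1) (u * g) := by
  rcases hu with rfl | rfl
  · rw [one_mul]; exact hg.mono n.le_succ
  · exact hg.A_mul

lemma exists_lenLE (g : GrigPres) : ∃ n, LenLE n g := by
  induction g using induction_left with
  | one => exact ⟨0, LenLE.one⟩
  | hA g ih => exact ih.imp' _ fun _ h => h.A_mul
  | hC g ih => exact ih.imp fun _ h => h.letter_mul (by simp [letters])
  | hD g ih => exact ih.imp fun _ h => h.letter_mul (by simp [letters])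

lemma AltWord.mul_letter {n : ℕ} {x g : GrigPres} (hx : x ∈ letters) (hg : AltWord n g)
    (hn : n ≠ 0) : AltWord n (g * x) := by
  induction hg with
  | one => exact absurd rfl hn
  | @cons n y g hy hg ih =>
    rcases eq_or_ne n 0 with rfl | hn
    · cases hg
      have h := AltWord.cons (mul_mem_letters hy hx) AltWord.one
      simpa only [mul_one, mul_assoc] using h
    · simpa only [mul_assoc] using AltWord.cons hy (ih hn)

lemma sections_letter {x : GrigPres} (hx : x ∈ letters) :
    ∃ u v, (u = 1 ∨ u = A) ∧ v ∈ letters ∧ sections x = pairPerm (u, v) := by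
  rcases hx with rfl | rfl | rfl | rfl
  · exact ⟨1, 1, Or.inl rfl, one_mem_letters, by rw [map_one]; exact (map_one pairPerm).symm⟩
  · exact ⟨A, D, Or.inr rfl, by simp [letters], sections_C⟩
  · exact ⟨1, C * D, Or.inl rfl, by simp [letters], sections_D⟩
  · exact ⟨A, C, Or.inr rfl, by simp [letters], by
      rw [map_mul, sections_C, sections_D, ← map_mul, Prod.mk_mul_mk, mul_one, D_mul_C_mul,
        D_mul_D, mul_one]⟩

lemma AltWord.sections_even {m : ℕ} {g : GrigPres} (hg : AltWord (2 * m) g) :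
    ∃ p q, sections g = pairPerm (p, q) ∧ LenLE m p ∧ LenLE m q := by
  induction m generalizing g with
  | zero =>
    cases hg
    exact ⟨1, 1, by rw [map_one]; exact (map_one pairPerm).symm, LenLE.one, LenLE.one⟩
  | succ m ih =>
    rw [Nat.mul_succ] at hg
    rcases hg with _ | ⟨hx, hg⟩
    rcases hg with _ | ⟨hy, hg⟩
    obtain ⟨p, q, hpq, hp, hq⟩ := ih hg
    obtain ⟨u, v, hu, hv, h⟩ := sections_letter hx
    obtain ⟨u', v', hu', hv', h'⟩ := sections_letter hy
    refine ⟨v * (u' * p), u * (v' * q), ?_, (hp.mul_of_eq hu').letter_mul hv,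
      (hq.letter_mul hv').mul_of_eq hu⟩
    rw [map_mul, map_mul, map_mul, map_mul, sections_A, h, h', hpq, ← mul_assoc, ← mul_assoc,
      swapPerm_mul_pairPerm_mul_swapPerm, ← map_mul, ← map_mul]
    rfl

lemma AltWord.sections_odd {m : ℕ} {g : GrigPres} (hg : AltWord (2 * m + 1) g) :
    ∃ p q, sections g = swapPerm GrigPres * pairPerm (p, q) := by
  rcases hg with _ | ⟨hx, hg⟩
  obtain ⟨p, q, hpq, -⟩ := hg.sections_even
  obtain ⟨u, v, -, -, h⟩ := sections_letter hx
  refine ⟨u * p, v * q, ?_⟩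
  rw [map_mul, map_mul, sections_A, h, hpq, ← map_mul]
  rfl

end GrigPres

lemma cns_head_tail_s7 (w : ℕ → Bool) : ∃ e v, w = cns e v :=
  ⟨w 0, fun n => w (n + 1), by funext n; cases n <;> rfl⟩

lemma cns_injective (e : Bool) : Function.Injective (cns e) := fun v w h => by
  funext n
  exact congrFun h (n + 1)

/-- The recursions defining the generators of the Grigorchuk group. -/
structure IsGrigorchuk (a b c d : Equiv.Perm (ℕ → Bool)) : Prop where
  a0 : ∀ w, a (cns false w) = cns true w
  a1 : ∀ w, a (cns true w) = cns false w
  b0 : ∀ w, b (cns false w) = cns false (a w)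
  b1 : ∀ w, b (cns true w) = cns true (c w)
  c0 : ∀ w, c (cns false w) = cns false (a w)
  c1 : ∀ w, c (cns true w) = cns true (d w)
  d0 : ∀ w, d (cns false w) = cns false w
  d1 : ∀ w, d (cns true w) = cns true (b w)

namespace IsGrigorchuk

variable {a b c d : Equiv.Perm (ℕ → Bool)}

lemma a_mul_a (h : IsGrigorchuk a b c d) : a * a = 1 := by
  ext1 w
  obtain ⟨e, v, rfl⟩ := cns_head_tail_s7 w
  cases e <;> simp [h.a0, h.a1]

lemma klein (h : IsGrigorchuk a b c d) (n : ℕ) (w : ℕ → Bool) :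
    b (b w) n = w n ∧ c (c w) n = w n ∧ d (d w) n = w n ∧
      b (c w) n = d w n ∧ c (b w) n = d w n ∧ c (d w) n = b w n ∧ d (c w) n = b w n ∧
      b (d w) n = c w n ∧ d (b w) n = c w n := by
  have haa (w) : a (a w) = w := DFunLike.congr_fun h.a_mul_a w
  induction n generalizing w with
  | zero =>
    obtain ⟨e, v, rfl⟩ := cns_head_tail_s7 w
    cases e <;> simp [h.b0, h.b1, h.c0, h.c1, h.d0, h.d1, cns]
  | succ n ih =>
    obtain ⟨e, v, rfl⟩ := cns_head_tail_s7 w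
    obtain ⟨h1, h2, h3, h4, h5, h6, h7, h8, h9⟩ := ih v
    cases e <;> simp [h.b0, h.b1, h.c0, h.c1, h.d0, h.d1, cns, *]

lemma c_mul_c (h : IsGrigorchuk a b c d) : c * c = 1 := by
  ext1 w
  funext n
  exact (h.klein n w).2.1

lemma d_mul_d (h : IsGrigorchuk a b c d) : d * d = 1 := by
  ext1 w
  funext n
  exact (h.klein n w).2.2.1

lemma c_mul_d (h : IsGrigorchuk a b c d) : c * d = b := by
  ext1 w
  funext n
  exact (h.klein n w).2.2.2.2.2.1

lemma d_mul_c (h : IsGrigorchuk a b c d) : d * c = b := by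
  ext1 w
  funext n
  exact (h.klein n w).2.2.2.2.2.2.1

lemma grigLift_apply (h : IsGrigorchuk a b c d) {G : Type*} [Group G]
    (φ : G →* Equiv.Perm (ℕ → Bool)) {x y z : G} (hx : φ x = a) (hy : φ y = c) (hz : φ z = d)
    (r : FreeGroup (Fin 3)) (w : ℕ → Bool) (p : Bool × G) :
    grigLift a c d r (cns p.1 (φ p.2 w)) =
      cns (grigSections x y z r p).1 (φ (grigSections x y z r p).2 w) := by
  have hb (v) : c (d v) = b v := DFunLike.congr_fun h.c_mul_d v
  induction r using FreeGroup.induction_on generalizing p with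
  | C1 => simp
  | of i =>
    obtain ⟨e, g⟩ := p
    fin_cases i <;> cases e <;>
      simp [grigSections, hx, hy, hz, h.a0, h.a1, h.c0, h.c1, h.d0, h.d1, hb]
  | inv_of i ih =>
    rw [map_inv, map_inv, Equiv.Perm.inv_eq_iff_eq, ih]
    simp
  | mul r s hr hs =>
    rw [map_mul, map_mul, Equiv.Perm.mul_apply, Equiv.Perm.mul_apply, hs, hr]

lemma grigLift_eq_one (h : IsGrigorchuk a b c d) {r : FreeGroup (Fin 3)}
    (hr : grigSections a c d r = 1) : grigLift a c d r = 1 := by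
  ext1 w
  obtain ⟨e, v, rfl⟩ := cns_head_tail_s7 w
  simpa [hr] using h.grigLift_apply (MonoidHom.id _) (x := a) (y := c) (z := d) rfl rfl rfl r v
    (e, 1)

lemma grigLift_rels (h : IsGrigorchuk a b c d) {r : FreeGroup (Fin 3)} (hr : r ∈ grigRels) :
    grigLift a c d r = 1 := by
  have hcd : d * c = c * d := by rw [h.d_mul_c, h.c_mul_d]
  have h2 := h.grigLift_eq_one (grigSections_pow_four h.c_mul_c h.d_mul_d hcd)
  have had : (a * d) ^ 4 = 1 := by simpa using h2
  refine grigRels_induction (P := fun r => grigLift a c d r = 1)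
    (h.grigLift_eq_one (grigSections_of_zero_mul_of_zero a c d)) h2
    (h.grigLift_eq_one (grigSections_long_pow_four h.a_mul_a h.c_mul_c h.d_mul_d hcd))
    (fun r hr ih => h.grigLift_eq_one ?_) hr
  rw [grigSections_sigma h.d_mul_d hcd, ih, grigLift_dihedral_rels h.a_mul_a h.d_mul_d
    (alternating_of_mul_pow_four h.a_mul_a h.d_mul_d had) hr]
  exact map_one _

/-- The homomorphism from `GrigPres` to the Grigorchuk group. -/
def toPerm (h : IsGrigorchuk a b c d) : GrigPres →* Equiv.Perm (ℕ → Bool) :=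
  GrigPres.lift (grigLift a c d) fun _ => h.grigLift_rels

open GrigPres

lemma toPerm_apply (h : IsGrigorchuk a b c d) (g : GrigPres) (w : ℕ → Bool)
    (p : Bool × GrigPres) :
    h.toPerm g (cns p.1 (h.toPerm p.2 w)) = cns (sections g p).1 (h.toPerm (sections g p).2 w) := by
  obtain ⟨r, rfl⟩ := PresentedGroup.mk_surjective _ g
  exact h.grigLift_apply h.toPerm (x := A) (y := C) (z := D) (by simp [toPerm]) (by simp [toPerm])
    (by simp [toPerm]) r w p

lemma toPerm_eq_one_of_sections (h : IsGrigorchuk a b c d) {g p q : GrigPres}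
    (hg : h.toPerm g = 1) (hpq : sections g = pairPerm (p, q)) :
    h.toPerm p = 1 ∧ h.toPerm q = 1 := by
  constructor <;> ext1 w
  · have hw := h.toPerm_apply g w (false, 1)
    simp only [hg, hpq, map_one, Equiv.Perm.one_apply, pairPerm_apply_false, mul_one] at hw
    exact (cns_injective _ hw).symm
  · have hw := h.toPerm_apply g w (true, 1)
    simp only [hg, hpq, map_one, Equiv.Perm.one_apply, pairPerm_apply_true, mul_one] at hw
    exact (cns_injective _ hw).symm

lemma eq_one_of_mem_letters (h : IsGrigorchuk a b c d) {x : GrigPres} (hx : x ∈ letters)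
    (h1 : h.toPerm x = 1) : x = 1 := by
  have ha : a ≠ 1 := fun ha => by
    have := congrFun (h.a0 fun _ => false) 0
    simp [ha, cns] at this
  have hA : h.toPerm A = a := by simp [toPerm]
  have hC : h.toPerm C ≠ 1 := fun hC =>
    ha (hA ▸ (h.toPerm_eq_one_of_sections hC sections_C).1)
  have hCD : h.toPerm (C * D) ≠ 1 := fun hCD => by
    have hs : sections (C * D) = pairPerm (A, D * (C * D)) := by
      rw [map_mul, sections_C, sections_D, ← map_mul, Prod.mk_mul_mk, mul_one]
    exact ha (hA ▸ (h.toPerm_eq_one_of_sections hCD hs).1)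
  rcases hx with rfl | rfl | rfl | rfl
  · rfl
  · exact absurd h1 hC
  · exact absurd (h.toPerm_eq_one_of_sections h1 sections_D).2 hCD
  · exact absurd h1 hCD

lemma eq_one_of_lenLE (h : IsGrigorchuk a b c d) {n : ℕ} {g : GrigPres} (hg : LenLE n g)
    (h1 : h.toPerm g = 1) : g = 1 := by
  induction n using Nat.strong_induction_on generalizing g with
  | _ n ih =>
    obtain ⟨m, hm, x, hx, k, hk, rfl⟩ := hg
    rcases eq_or_ne m 0 with rfl | hm0
    · cases hk
      rw [mul_one] at h1 ⊢
      exact h.eq_one_of_mem_letters hx h1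
    have hkx := hk.mul_letter hx hm0
    have hconj : x * k = x * (k * x) * x⁻¹ := by group
    rw [hconj, map_mul, map_mul, map_inv, conj_eq_one_iff] at h1
    rw [hconj, conj_eq_one_iff]
    obtain ⟨j, rfl | rfl⟩ := m.even_or_odd'
    · obtain ⟨p, q, hpq, hp, hq⟩ := hkx.sections_even
      obtain ⟨hp1, hq1⟩ := h.toPerm_eq_one_of_sections h1 hpq
      have hjn : j < n := by omega
      apply sections_injective
      rw [hpq, ih j hjn hp hp1, ih j hjn hq hq1, map_one]
      exact map_one pairPerm
    · obtain ⟨p, q, hpq⟩ := hkx.sections_odd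
      have hw := congrFun (h.toPerm_apply (k * x) (fun _ => false) (false, 1)) 0
      simp [h1, hpq, cns] at hw

lemma toPerm_injective (h : IsGrigorchuk a b c d) : Function.Injective h.toPerm :=
  (injective_iff_map_eq_one _).2 fun g hg =>
    (exists_lenLE g).elim fun _ hn => h.eq_one_of_lenLE hn hg

lemma range_grigLift (h : IsGrigorchuk a b c d) :
    (grigLift a c d).range = Subgroup.closure {a, b, c, d} := by
  apply le_antisymm
  · refine FreeGroup.range_lift_le ?_
    rintro _ ⟨i, rfl⟩
    apply Subgroup.subset_closure
    fin_cases i <;> simp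
  · refine (Subgroup.closure_le _).2 ?_
    rintro _ (rfl | rfl | rfl | rfl)
    · exact ⟨FreeGroup.of 0, by simp⟩
    · exact ⟨FreeGroup.of 1 * FreeGroup.of 2, by simp [h.c_mul_d]⟩
    · exact ⟨FreeGroup.of 1, by simp⟩
    · exact ⟨FreeGroup.of 2, by simp⟩

lemma ker_grigLift (h : IsGrigorchuk a b c d) :
    (grigLift a c d).ker = Subgroup.normalClosure grigRels := by
  ext x
  rw [← PresentedGroup.mk_eq_one_iff, MonoidHom.mem_ker]
  exact map_eq_one_iff h.toPerm h.toPerm_injective (x := PresentedGroup.mk grigRels x)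

end IsGrigorchuk

/-- Lysionok's `L`-presentation of the Grigorchuk group:
`𝐆 = ⟨a, c, d | σⁱ(a²), σⁱ((ad)⁴), σⁱ((adacac)⁴), i ≥ 0⟩`. -/
theorem grigorchuk_L_presentation
    (a b c d : Equiv.Perm (ℕ → Bool))
    (ha0 : ∀ w, a (cns false w) = cns true w)
    (ha1 : ∀ w, a (cns true w) = cns false w)
    (hb0 : ∀ w, b (cns false w) = cns false (a w))
    (hb1 : ∀ w, b (cns true w) = cns true (c w))
    (hc0 : ∀ w, c (cns false w) = cns false (a w))
    (hc1 : ∀ w, c (cns true w) = cns true (d w))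
    (hd0 : ∀ w, d (cns false w) = cns false w)
    (hd1 : ∀ w, d (cns true w) = cns true (b w)) :
    (FreeGroup.lift fun i : Fin 3 =>
        if i = 0 then a else if i = 1 then c else d).range
      = Subgroup.closure ({a, b, c, d} : Set (Equiv.Perm (ℕ → Bool))) ∧
    (FreeGroup.lift fun i : Fin 3 =>
        if i = 0 then a else if i = 1 then c else d).ker
      = Subgroup.normalClosure
          {x : FreeGroup (Fin 3) | ∃ i : ℕ,
            x = (grigSigma ^ i) (FreeGroup.of 0 * FreeGroup.of 0) ∨
            x = (grigSigma ^ i) ((FreeGroup.of 0 * FreeGroup.of 2) ^ 4) ∨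
            x = (grigSigma ^ i) ((FreeGroup.of 0 * FreeGroup.of 2 * FreeGroup.of 0 *
              FreeGroup.of 1 * FreeGroup.of 0 * FreeGroup.of 1) ^ 4)} := by
  have h : IsGrigorchuk a b c d := ⟨ha0, ha1, hb0, hb1, hc0, hc1, hd0, hd1⟩
  exact ⟨h.range_grigLift, h.ker_grigLift⟩
end
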